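/- Let n ≥ 2, p > 0, and let f : B → ℝⁿ \ {0} be a K-quasiregular mapping in the Miniowitz class (Min) with constants C₀, α, satisfying the multiplicity condition (M) with exponent 0 ≤ a < n−1 and constant C₁. Then f ∈ H^p if and only if ∫_B |f(x)|^{p−1} ‖Df(x)‖ dx < ∞. -/

import Mathlib

open MeasureTheory Metric Set Filter
open scoped ENNReal NNReal Topology Classical

noncomputable section

abbrev Vec (n : ℕ) := EuclideanSpace ℝ (Fin n)

/-- The open unit ball in `ℝⁿ`. -/
def unitBall (n : ℕ) : Set (Vec n) := Metric.ball 0 1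

/-- The unit sphere `S^{n-1}` in `ℝⁿ`. -/
def unitSphere (n : ℕ) : Set (Vec n) := Metric.sphere 0 1

/-- Surface measure on the unit sphere, modelled by `(n-1)`-dimensional
Hausdorff measure restricted to the sphere. -/
def sphMeasure (n : ℕ) : Measure (Vec n) := (μH[(n : ℝ) - 1]).restrict (unitSphere n)

/-- `f` is `K`-quasiregular on the unit ball. -/
def IsQR (n : ℕ) (K : ℝ) (f : Vec n → Vec n) : Prop :=
  ContinuousOn f (unitBall n) ∧
  (∀ x ∈ unitBall n, DifferentiableAt ℝ f x) ∧
  (∀ᵐ x ∂(volume.restrict (unitBall n)),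
    ‖fderiv ℝ f x‖ ^ n ≤ K * (fderiv ℝ f x).det)

/-- The conformal automorphism `T_x` of the unit ball (with `T_0 = id`). -/
def mobiusT (n : ℕ) (x : Vec n) (y : Vec n) : Vec n :=
  if x = 0 then y
  else (‖x‖ ^ 2 * ‖y - (‖x‖ ^ 2)⁻¹ • x‖ ^ 2)⁻¹ •
    ((1 - ‖x‖ ^ 2) • (y - x) - ‖y - x‖ ^ 2 • x)

/-- The Miniowitz class (Min) with constants `C₀, α`. -/
def InMiniowitz (n : ℕ) (C₀ α : ℝ) (f : Vec n → Vec n) : Prop :=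
  ∀ x ∈ unitBall n, ∀ y ∈ unitBall n,
    C₀⁻¹ * ((1 - ‖y‖) / (1 + ‖y‖)) ^ α ≤ ‖f (mobiusT n (-x) y)‖ / ‖f (mobiusT n (-x) 0)‖ ∧
    ‖f (mobiusT n (-x) y)‖ / ‖f (mobiusT n (-x) 0)‖ ≤ C₀ * ((1 + ‖y‖) / (1 - ‖y‖)) ^ α

/-- The multiplicity condition (M) with exponent `a` and constant `C₁`. -/
def MultCond (n : ℕ) (a C₁ : ℝ) (f : Vec n → Vec n) : Prop :=
  ∀ x ∈ unitBall n, ∀ r : ℝ, 0 < r → r < 1 → ∀ y : Vec n,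
    (({z ∈ Metric.ball (0 : Vec n) r | f (mobiusT n (-x) z) = y}).encard : ℝ≥0∞) ≤
      ENNReal.ofReal (C₁ / (1 - r) ^ a)

/-- The non-tangential region `Γ(ω)` with aperture parameter `κ`. -/
def ntRegion (n : ℕ) (κ : ℝ) (ω : Vec n) : Set (Vec n) :=
  {x ∈ unitBall n | ‖x - ω‖ < (1 + κ) * (1 - ‖x‖)}

/-- The non-tangential maximal function `f*`. -/
def ntMax (n : ℕ) (κ : ℝ) (f : Vec n → Vec n) (ω : Vec n) : ℝ≥0∞ :=
  ⨆ x ∈ ntRegion n κ ω, ENNReal.ofReal ‖f x‖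

/-- `f` has the non-tangential limit `L` at `ω`. -/
def HasNTLimit (n : ℕ) (κ : ℝ) (f : Vec n → Vec n) (ω L : Vec n) : Prop :=
  Filter.Tendsto f (𝓝[ntRegion n κ ω] ω) (𝓝 L)

/-- The `p`-th mean of `f` on the sphere of radius `r`. -/
def hardyMean (n : ℕ) (p : ℝ) (f : Vec n → Vec n) (r : ℝ) : ℝ≥0∞ :=
  (sphMeasure n (unitSphere n))⁻¹ *
    ∫⁻ ω, ENNReal.ofReal (‖f (r • ω)‖ ^ p) ∂(sphMeasure n)

/-- The Hardy `H^p` norm of `f` on the unit ball. -/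
def hardyNorm (n : ℕ) (p : ℝ) (f : Vec n → Vec n) : ℝ≥0∞ :=
  (⨆ r ∈ Set.Ioo (0 : ℝ) 1, hardyMean n p f r) ^ (1 / p)

/-- `f` belongs to the Hardy space `H^p`. -/
def MemHp (n : ℕ) (p : ℝ) (f : Vec n → Vec n) : Prop := hardyNorm n p f < ⊤

/-- The `L^p(σ)` norm of a boundary function on the unit sphere. -/
def lpSphere (n : ℕ) (p : ℝ) (g : Vec n → Vec n) : ℝ≥0∞ :=
  (∫⁻ ω, ENNReal.ofReal (‖g ω‖ ^ p) ∂(sphMeasure n)) ^ (1 / p)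

/-- The `L^p(σ)` norm of the non-tangential maximal function `f*`. -/
def ntMaxLp (n : ℕ) (κ p : ℝ) (f : Vec n → Vec n) : ℝ≥0∞ :=
  (∫⁻ ω, (ntMax n κ f ω) ^ p ∂(sphMeasure n)) ^ (1 / p)

/-- `μ` is a Carleson measure on the unit ball with constant `c`. -/
def IsCarleson (n : ℕ) (c : ℝ) (μ : Measure (Vec n)) : Prop :=
  ∀ ω ∈ unitSphere n, ∀ r : ℝ, 0 < r →
    μ (unitBall n ∩ Metric.ball ω r) ≤ ENNReal.ofReal c * ENNReal.ofReal r ^ ((n : ℝ) - 1)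

/-- `μ` is an `α`-Carleson measure on the unit ball with constant `γ`. -/
def IsAlphaCarleson (n : ℕ) (α γ : ℝ) (μ : Measure (Vec n)) : Prop :=
  ∀ ω ∈ unitSphere n, ∀ r : ℝ, 0 < r →
    μ (unitBall n ∩ Metric.ball ω r) ≤
      ENNReal.ofReal γ * ENNReal.ofReal r ^ (α * ((n : ℝ) - 1))


/-- The surface measure on the unit sphere coming from polar coordinates. -/
def surf (n : ℕ) : Measure (Vec n) := (volume : Measure (Vec n)).toSphere.map Subtype.val

instance (n : ℕ) : IsFiniteMeasure (surf n) := by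
  unfold surf; infer_instance

lemma surf_ae_norm (n : ℕ) : ∀ᵐ ω ∂(surf n), ‖ω‖ = 1 := by
  unfold surf
  rw [ae_map_iff measurable_subtype_coe.aemeasurable
    (measurableSet_eq_fun measurable_norm measurable_const)]
  exact Eventually.of_forall fun x => by simp

lemma lintegral_polar {n : ℕ} (hn : 1 ≤ n) {h : Vec n → ℝ≥0∞} (hm : Measurable h) :
    ∫⁻ x, h x =
      ∫⁻ ω, (∫⁻ t in Ioi (0 : ℝ), ENNReal.ofReal (t ^ (n - 1)) * h (t • ω)) ∂(surf n) := by
  have : NeZero n := ⟨by omega⟩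
  have hmp := (volume : Measure (Vec n)).measurePreserving_homeomorphUnitSphereProd
  rw [finrank_euclideanSpace_fin] at hmp
  have hj : Measurable (fun q : (sphere (0 : Vec n) 1) × (Ioi (0 : ℝ)) =>
      h ((q.2 : ℝ) • (q.1 : Vec n))) := by
    apply hm.comp; fun_prop
  have h1 : ∫⁻ x, h x = ∫⁻ x in ({0}ᶜ : Set (Vec n)), h x := by
    rw [restrict_compl_singleton]
  rw [h1, ← lintegral_subtype_comap (measurableSet_singleton _).compl]
  have h2 := hmp.lintegral_comp hj
  rw [lintegral_prod _ hj.aemeasurable] at h2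
  have h3 : ∀ a : ({0}ᶜ : Set (Vec n)), h (((homeomorphUnitSphereProd (Vec n) a).2 : ℝ) •
      ((homeomorphUnitSphereProd (Vec n) a).1 : Vec n)) = h a := by
    intro a
    have ha : (a : Vec n) ≠ 0 := a.2
    simp [smul_smul, ha]
  simp only [h3] at h2
  rw [h2, surf, lintegral_map _ measurable_subtype_coe]
  · apply lintegral_congr
    intro ω
    have hq : Measurable (fun t : Ioi (0 : ℝ) => ENNReal.ofReal ((t : ℝ) ^ (n - 1))) := by fun_prop
    rw [Measure.volumeIoiPow, lintegral_withDensity_eq_lintegral_mul _ hq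
      (g := fun t : Ioi (0 : ℝ) => h ((t : ℝ) • (ω : Vec n)))
      (hj.comp (measurable_prodMk_left (x := ω)))]
    rw [← lintegral_subtype_comap measurableSet_Ioi]
    rfl
  · apply Measurable.lintegral_prod_right'
      (f := fun q : Vec n × ℝ => ENNReal.ofReal (q.2 ^ (n - 1)) * h (q.2 • q.1))
    apply Measurable.mul
    · fun_prop
    · exact hm.comp (by fun_prop)

lemma volume_le_of_subset_sector {n : ℕ} (hn : 1 ≤ n) {A D : Set (Vec n)} (hA : MeasurableSet A)
    (hD : MeasurableSet D) {a b : ℝ} (hb : 0 ≤ b)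
    (h : ∀ x ∈ A, x ≠ 0 → ‖x‖ ∈ Icc a b ∧ ‖x‖⁻¹ • x ∈ D) :
    volume A ≤ ENNReal.ofReal (b ^ (n - 1) * (b - a)) * surf n D := by
  rw [← lintegral_indicator_one hA, lintegral_polar hn (measurable_one.indicator hA)]
  calc _ ≤ ∫⁻ ω, D.indicator (fun _ => ENNReal.ofReal (b ^ (n - 1) * (b - a))) ω ∂(surf n) := by
        apply lintegral_mono_ae
        filter_upwards [surf_ae_norm n] with ω hω
        have key : ∀ t ∈ Ioi (0 : ℝ), t • ω ∈ A → t ∈ Icc a b ∧ ω ∈ D := by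
          intro t ht htA
          have ht0 : 0 < t := ht
          have hω0 : ω ≠ 0 := by rintro rfl; simp at hω
          have := h _ htA (smul_ne_zero ht0.ne' hω0)
          rw [norm_smul, hω, Real.norm_of_nonneg ht0.le, mul_one, smul_smul,
            inv_mul_cancel₀ ht0.ne', one_smul] at this
          exact this
        by_cases hωD : ω ∈ D
        · rw [indicator_of_mem hωD]
          calc _ ≤ ∫⁻ t in Ioi (0 : ℝ), (Icc a b).indicator
                  (fun _ => ENNReal.ofReal (b ^ (n - 1))) t := by
                apply setLIntegral_mono' measurableSet_Ioi
                intro t ht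
                have ht0 : 0 < t := ht
                by_cases htA : t • ω ∈ A
                · have := (key t ht htA).1
                  rw [indicator_of_mem htA, indicator_of_mem this]
                  simp only [Pi.one_apply, mul_one]
                  exact ENNReal.ofReal_le_ofReal (by gcongr; exact this.2)
                · simp [htA]
            _ ≤ ∫⁻ t, (Icc a b).indicator (fun _ => ENNReal.ofReal (b ^ (n - 1))) t :=
                setLIntegral_le_lintegral _ _
            _ = _ := by
                rw [lintegral_indicator measurableSet_Icc, setLIntegral_const, Real.volume_Icc,
                  ENNReal.ofReal_mul (by positivity)]
        · rw [indicator_of_notMem hωD]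
          simp only [nonpos_iff_eq_zero]
          rw [setLIntegral_eq_zero_iff' measurableSet_Ioi]
          · filter_upwards with t ht
            have : t • ω ∉ A := fun hh => hωD (key t ht hh).2
            simp [this]
          · apply Measurable.aemeasurable
            apply Measurable.mul (by fun_prop)
            exact (measurable_one.indicator hA).comp (by fun_prop)
    _ = _ := by
      rw [lintegral_indicator hD, setLIntegral_const]

lemma surf_mul_le_volume {n : ℕ} (hn : 1 ≤ n) {A D : Set (Vec n)} (hA : MeasurableSet A)
    (hD : MeasurableSet D) {a b : ℝ} (ha : 1 ≤ a)
    (h : ∀ ω ∈ D, ‖ω‖ = 1 → ∀ t ∈ Icc a b, t • ω ∈ A) :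
    ENNReal.ofReal (b - a) * surf n D ≤ volume A := by
  rw [← lintegral_indicator_one hA, lintegral_polar hn (measurable_one.indicator hA)]
  calc _ = ∫⁻ ω, D.indicator (fun _ => ENNReal.ofReal (b - a)) ω ∂(surf n) := by
        rw [lintegral_indicator hD, setLIntegral_const]
    _ ≤ _ := by
      apply lintegral_mono_ae
      filter_upwards [surf_ae_norm n] with ω hω
      by_cases hωD : ω ∈ D
      · rw [indicator_of_mem hωD]
        calc _ = ∫⁻ t in Icc a b, 1 := by rw [setLIntegral_one, Real.volume_Icc]
          _ ≤ ∫⁻ t in Icc a b, ENNReal.ofReal (t ^ (n - 1)) * A.indicator 1 (t • ω) := by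
            apply setLIntegral_mono' measurableSet_Icc
            intro t ht
            rw [indicator_of_mem (h ω hωD hω t ht)]
            simp only [Pi.one_apply, mul_one, ENNReal.one_le_ofReal]
            exact one_le_pow₀ (ha.trans ht.1)
          _ ≤ _ := by
            apply lintegral_mono_set
            intro t ht
            exact lt_of_lt_of_le one_pos (ha.trans ht.1)
      · rw [indicator_of_notMem hωD]; exact zero_le

lemma norm_inv_smul_sub_self {n : ℕ} {x : Vec n} (hx : x ≠ 0) : ‖‖x‖⁻¹ • x - x‖ = |1 - ‖x‖| := by
  have h0 : ‖x‖ ≠ 0 := norm_ne_zero_iff.2 hx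
  have : ‖x‖⁻¹ • x - x = (‖x‖⁻¹ - 1) • x := by rw [sub_smul, one_smul]
  rw [this, norm_smul, Real.norm_eq_abs]
  nth_rw 2 [← abs_of_nonneg (norm_nonneg x)]
  rw [← abs_mul]
  congr 1
  field_simp

lemma exists_surf_closedBall_le {n : ℕ} (hn : 1 ≤ n) : ∃ C : ℝ, 0 < C ∧ ∀ ω : Vec n, ‖ω‖ = 1 →
    ∀ ρ : ℝ, 0 < ρ → surf n (closedBall ω ρ) ≤ ENNReal.ofReal (C * ρ ^ (n - 1)) := by
  have : NeZero n := ⟨by omega⟩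
  set V := (volume : Measure (Vec n)).real (closedBall 0 1) with hV
  have hVpos : 0 < V := ENNReal.toReal_pos (measure_closedBall_pos _ _ one_pos).ne'
    measure_closedBall_lt_top.ne
  refine ⟨2 ^ n * V, by positivity, fun ω hω ρ hρ => ?_⟩
  have h1 := surf_mul_le_volume hn (A := closedBall ω (2 * ρ)) (D := closedBall ω ρ) (a := 1)
    (b := 1 + ρ) measurableSet_closedBall measurableSet_closedBall le_rfl (by
      intro ζ hζ hζ1 t ht
      rw [mem_closedBall, dist_eq_norm] at *
      calc ‖t • ζ - ω‖ = ‖(t - 1) • ζ + (ζ - ω)‖ := by congr 1; rw [sub_smul, one_smul]; abel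
        _ ≤ ‖(t - 1) • ζ‖ + ‖ζ - ω‖ := norm_add_le _ _
        _ ≤ ρ + ρ := by
          rw [norm_smul, hζ1, mul_one, Real.norm_of_nonneg (by linarith [ht.1])]
          linarith [ht.2]
        _ = 2 * ρ := by ring)
  rw [Measure.addHaar_closedBall' volume _ (by positivity), finrank_euclideanSpace_fin,
    show volume (closedBall (0 : Vec n) 1) = ENNReal.ofReal V by
      rw [hV, ofReal_measureReal measure_closedBall_lt_top.ne], ← ENNReal.ofReal_mul (by positivity),
    add_sub_cancel_left] at h1
  have h2 : (2 * ρ) ^ n * V = ρ * (2 ^ n * V * ρ ^ (n - 1)) := by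
    obtain ⟨m, rfl⟩ : ∃ m, n = m + 1 := ⟨n - 1, by omega⟩
    simp only [Nat.add_sub_cancel]; ring
  rw [h2, ENNReal.ofReal_mul hρ.le] at h1
  exact (ENNReal.mul_le_mul_iff_right (by simpa using hρ) ENNReal.ofReal_ne_top).1 h1

lemma exists_le_surf_closedBall {n : ℕ} (hn : 1 ≤ n) : ∃ c : ℝ, 0 < c ∧ ∀ ω : Vec n, ‖ω‖ = 1 →
    ∀ ρ : ℝ, 0 < ρ → ρ ≤ 1 → ENNReal.ofReal (c * ρ ^ (n - 1)) ≤ surf n (closedBall ω ρ) := by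
  have : NeZero n := ⟨by omega⟩
  set V := (volume : Measure (Vec n)).real (closedBall 0 1) with hV
  have hVpos : 0 < V := ENNReal.toReal_pos (measure_closedBall_pos _ _ one_pos).ne'
    measure_closedBall_lt_top.ne
  refine ⟨V / (2 ^ n * 2 ^ (n - 1)), by positivity, fun ω hω ρ hρ hρ1 => ?_⟩
  have h1 := volume_le_of_subset_sector hn (A := closedBall ω (ρ / 2)) (D := closedBall ω ρ)
    (a := 1 - ρ / 2) (b := 1 + ρ / 2) measurableSet_closedBall measurableSet_closedBall
    (by positivity) (by
      intro x hx hx0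
      rw [mem_closedBall, dist_eq_norm] at *
      have h3 : |‖x‖ - ‖ω‖| ≤ ρ / 2 := (abs_norm_sub_norm_le x ω).trans hx
      rw [hω] at h3
      refine ⟨⟨by linarith [(abs_le.1 h3).1], by linarith [(abs_le.1 h3).2]⟩, ?_⟩
      calc ‖‖x‖⁻¹ • x - ω‖ ≤ ‖‖x‖⁻¹ • x - x‖ + ‖x - ω‖ := norm_sub_le_norm_sub_add_norm_sub _ _ _
        _ ≤ ρ / 2 + ρ / 2 := by
          rw [norm_inv_smul_sub_self hx0, abs_sub_comm]; gcongr
        _ = ρ := by ring)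
  rw [Measure.addHaar_closedBall' volume _ (by positivity), finrank_euclideanSpace_fin,
    show volume (closedBall (0 : Vec n) 1) = ENNReal.ofReal V by
      rw [hV, ofReal_measureReal measure_closedBall_lt_top.ne],
    ← ENNReal.ofReal_mul (by positivity)] at h1
  have h2 : (ρ / 2) ^ n * V = (2 ^ (n - 1) * ρ) * (V / (2 ^ n * 2 ^ (n - 1)) * ρ ^ (n - 1)) := by
    obtain ⟨m, rfl⟩ : ∃ m, n = m + 1 := ⟨n - 1, by omega⟩
    simp only [Nat.add_sub_cancel]; rw [div_pow, pow_succ ρ]; field_simp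
  have h4 : (1 + ρ / 2) ^ (n - 1) * (1 + ρ / 2 - (1 - ρ / 2)) ≤ 2 ^ (n - 1) * ρ := by
    have : 1 + ρ / 2 - (1 - ρ / 2) = ρ := by ring
    rw [this]; gcongr; linarith
  have h5 := h1.trans (mul_le_mul_left (ENNReal.ofReal_le_ofReal h4) _)
  rw [h2, ENNReal.ofReal_mul (by positivity)] at h5
  exact (ENNReal.mul_le_mul_iff_right (by simpa using hρ) ENNReal.ofReal_ne_top).1 h5

/-- The part of the shell of thickness `s` near the sphere inside a ball of radius `5 * r`. -/
lemma exists_volume_shell_le {n : ℕ} (hn : 1 ≤ n) : ∃ C : ℝ, 0 < C ∧ ∀ ω : Vec n, ‖ω‖ = 1 →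
    ∀ r : ℝ, 0 < r → ∀ s : ℝ, 0 < s → s ≤ r →
    volume {z ∈ unitBall n | ‖z - ω‖ ≤ 5 * r ∧ 1 - s ≤ ‖z‖} ≤
      ENNReal.ofReal (C * s * r ^ (n - 1)) := by
  obtain ⟨C, hC, h⟩ := exists_surf_closedBall_le hn
  refine ⟨C * 6 ^ (n - 1), by positivity, fun ω hω r hr s hs hsr => ?_⟩
  have hmeas : MeasurableSet {z ∈ unitBall n | ‖z - ω‖ ≤ 5 * r ∧ 1 - s ≤ ‖z‖} := by
    apply measurableSet_ball.inter
    exact (measurableSet_le (f := fun z : Vec n => ‖z - ω‖) (by fun_prop) measurable_const).inter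
      (measurableSet_le measurable_const measurable_norm)
  have h1 := volume_le_of_subset_sector hn (D := closedBall ω (6 * r)) (a := 1 - s) (b := 1)
    hmeas measurableSet_closedBall zero_le_one (by
      rintro z ⟨hz, hz1, hz2⟩ hz0
      have hz' : ‖z‖ < 1 := by simpa [unitBall] using hz
      refine ⟨⟨hz2, hz'.le⟩, ?_⟩
      rw [mem_closedBall, dist_eq_norm]
      calc ‖‖z‖⁻¹ • z - ω‖ ≤ ‖‖z‖⁻¹ • z - z‖ + ‖z - ω‖ := norm_sub_le_norm_sub_add_norm_sub _ _ _
        _ ≤ r + 5 * r := by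
          rw [norm_inv_smul_sub_self hz0, abs_of_nonneg (by linarith)]
          gcongr; linarith
        _ = 6 * r := by ring)
  refine h1.trans ((mul_le_mul_right (h ω hω (6 * r) (by positivity)) _).trans ?_)
  rw [← ENNReal.ofReal_mul (by simp; linarith)]
  apply ENNReal.ofReal_le_ofReal
  rw [one_pow, mul_pow]
  apply le_of_eq; ring

lemma exists_surf_le_sphMeasure {n : ℕ} (hn : 2 ≤ n) :
    ∃ C : ℝ, 0 < C ∧ surf n ≤ ENNReal.ofReal C • sphMeasure n := by
  obtain ⟨C, hC, h⟩ := exists_surf_closedBall_le (n := n) (by omega)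
  refine ⟨C, hC, ?_⟩
  have hC0 : ENNReal.ofReal C ≠ 0 := by simpa using hC
  have h1 : (ENNReal.ofReal C)⁻¹ • surf n ≤ μH[(n : ℝ) - 1] := by
    refine Measure.le_hausdorffMeasure _ _ 1 one_pos fun s hs => ?_
    rw [Measure.smul_apply, smul_eq_mul, mul_comm, ← div_eq_mul_inv]
    refine ENNReal.div_le_of_le_mul ?_
    by_cases hne : (s ∩ unitSphere n).Nonempty
    · obtain ⟨ω, hωs, hω⟩ := hne
      have hω1 : ‖ω‖ = 1 := by simpa [unitSphere] using hω
      have hbd : Bornology.IsBounded s :=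
        Metric.isBounded_iff_ediam_ne_top.2 (hs.trans_lt ENNReal.one_lt_top).ne
      have h2 : ∀ δ : ℝ, 0 < δ → surf n s ≤ ENNReal.ofReal (C * (diam s + δ) ^ (n - 1)) := by
        intro δ hδ
        refine (measure_mono fun y hy => ?_).trans (h ω hω1 (diam s + δ)
          (by have := diam_nonneg (s := s); positivity))
        rw [mem_closedBall]
        linarith [dist_le_diam_of_mem hbd hy hωs]
      have h3 : Tendsto (fun δ : ℝ => ENNReal.ofReal (C * (diam s + δ) ^ (n - 1))) (𝓝[>] 0)
          (𝓝 (ENNReal.ofReal (C * (diam s + 0) ^ (n - 1)))) := by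
        apply Tendsto.mono_left _ nhdsWithin_le_nhds
        apply ENNReal.tendsto_ofReal
        apply Continuous.tendsto
        fun_prop
      have h4 := ge_of_tendsto h3 (eventually_mem_nhdsWithin.mono fun δ hδ => h2 δ hδ)
      refine h4.trans (le_of_eq ?_)
      rw [add_zero, ENNReal.ofReal_mul hC.le, mul_comm, ENNReal.ofReal_pow diam_nonneg,
        Metric.diam, ENNReal.ofReal_toReal (hs.trans_lt ENNReal.one_lt_top).ne,
        ← ENNReal.rpow_natCast, Nat.cast_sub (by omega)]
      simp
    · have : surf n s = 0 := by
        refine measure_mono_null (t := {ω | ‖ω‖ = 1}ᶜ) (fun y hy hy1 => hne ⟨y, hy, ?_⟩)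
          (surf_ae_norm n)
        simpa [unitSphere] using hy1
      rw [this]; exact zero_le
  refine Measure.le_iff.2 fun s hs => ?_
  have hS : MeasurableSet (unitSphere n) := isClosed_sphere.measurableSet
  have h5 : surf n s = surf n (s ∩ unitSphere n) := by
    refine measure_congr ?_
    filter_upwards [surf_ae_norm n] with ω hω
    have : ω ∈ unitSphere n := by simpa [unitSphere] using hω
    apply propext
    exact ⟨fun hh => ⟨hh, this⟩, fun hh => hh.1⟩
  have h6 := h1 (s ∩ unitSphere n)
  rw [Measure.smul_apply, smul_eq_mul] at *
  rw [sphMeasure, Measure.restrict_apply hs, h5]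
  exact (ENNReal.inv_mul_le_iff hC0 ENNReal.ofReal_ne_top).1 h6

lemma exists_sphMeasure_le_surf {n : ℕ} (hn : 2 ≤ n) :
    ∃ C : ℝ, 0 < C ∧ sphMeasure n ≤ ENNReal.ofReal C • surf n := by
  obtain ⟨c, hc, h⟩ := exists_le_surf_closedBall (n := n) (by omega)
  have hC : 0 < 10 ^ (n - 1) / c := by positivity
  refine ⟨10 ^ (n - 1) / c, hC, ?_⟩
  have hS : MeasurableSet (unitSphere n) := isClosed_sphere.measurableSet
  have hopen : ∀ U : Set (Vec n), IsOpen U →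
      μH[(n : ℝ) - 1] (U ∩ unitSphere n) ≤ ENNReal.ofReal (10 ^ (n - 1) / c) * surf n U := by
    intro U hU
    let δ : ℕ → ℝ := fun k => 1 / ((k : ℝ) + 1)
    have hδ : ∀ k, 0 < δ k := fun k => by positivity
    let t : ℕ → Set (Vec n × ℝ) := fun k =>
      {q | q.1 ∈ unitSphere n ∧ 0 < q.2 ∧ q.2 ≤ δ k ∧ closedBall q.1 q.2 ⊆ U}
    have hV := fun k => Vitali.exists_disjoint_subfamily_covering_enlargement_closedBall
      (t k) (fun q => q.1) (fun q => q.2) (δ k) (fun q hq => hq.2.2.1) 5 (by norm_num)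
    choose u hut hud hucov using hV
    have hcount : ∀ k, (u k).Countable := fun k =>
      (hud k).countable_of_nonempty_interior fun q hq => by
        have := (hut k hq).2.1
        exact ⟨q.1, ball_subset_interior_closedBall (mem_ball_self this)⟩
    have : ∀ k, Countable (u k) := fun k => (hcount k).to_subtype
    have hdiam : ∀ k (i : u k), ediam (closedBall i.1.1 (5 * i.1.2)) ≤
        ENNReal.ofReal (10 * i.1.2) := by
      intro k i
      have hi := (hut k i.2).2.1
      refine ediam_le fun x hx y hy => ?_
      rw [edist_dist]
      apply ENNReal.ofReal_le_ofReal
      have := dist_triangle_right x y i.1.1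
      rw [mem_closedBall] at hx hy
      linarith
    have h1 := Measure.hausdorffMeasure_le_liminf_tsum (l := atTop) ((n : ℝ) - 1)
      (U ∩ unitSphere n) (fun k => ENNReal.ofReal (10 * δ k))
      (by
        rw [← ENNReal.ofReal_zero]
        apply ENNReal.tendsto_ofReal
        have := (tendsto_one_div_add_atTop_nhds_zero_nat (𝕜 := ℝ)).const_mul 10
        simpa [δ] using this)
      (fun k (i : u k) => closedBall i.1.1 (5 * i.1.2))
      (Eventually.of_forall fun k i => (hdiam k i).trans (ENNReal.ofReal_le_ofReal (by
        have := (hut k i.2).2.2.1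
        linarith)))
      (Eventually.of_forall fun k ω hω => by
        obtain ⟨ε, hε, hεU⟩ := Metric.isOpen_iff.1 hU ω hω.1
        have hq : (ω, min (ε / 2) (δ k)) ∈ t k := by
          refine ⟨hω.2, lt_min (by positivity) (hδ k), min_le_right _ _, ?_⟩
          refine (closedBall_subset_ball ?_).trans hεU
          exact (min_le_left _ _).trans_lt (by linarith)
        obtain ⟨b, hb, hsub⟩ := hucov k _ hq
        refine mem_iUnion.2 ⟨⟨b, hb⟩, hsub (mem_closedBall_self hq.2.1.le)⟩)
    refine h1.trans (liminf_le_of_frequently_le' (Frequently.of_forall fun k => ?_))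
    calc ∑' i : u k, ediam (closedBall i.1.1 (5 * i.1.2)) ^ ((n : ℝ) - 1)
        ≤ ∑' i : u k, ENNReal.ofReal (10 ^ (n - 1) / c) * surf n (closedBall i.1.1 i.1.2) := by
          apply ENNReal.tsum_le_tsum
          intro i
          obtain ⟨hi1, hi2, hi3, hi4⟩ := hut k i.2
          have hi1' : ‖i.1.1‖ = 1 := by simpa [unitSphere] using hi1
          have hi5 : i.1.2 ≤ 1 := hi3.trans (by
            simp only [δ]
            rw [div_le_one (by positivity)]
            linarith [(Nat.cast_nonneg k : (0 : ℝ) ≤ k)])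
          calc _ ≤ ENNReal.ofReal (10 * i.1.2) ^ ((n : ℝ) - 1) := by
                apply ENNReal.rpow_le_rpow (hdiam k i)
                have : (2 : ℝ) ≤ n := by exact_mod_cast hn
                linarith
            _ = ENNReal.ofReal (10 ^ (n - 1) / c) * ENNReal.ofReal (c * i.1.2 ^ (n - 1)) := by
                rw [← ENNReal.ofReal_mul hC.le, show ((n : ℝ) - 1) = ((n - 1 : ℕ) : ℝ) by
                  rw [Nat.cast_sub (by omega)]; simp, ENNReal.rpow_natCast,
                  ← ENNReal.ofReal_pow (by positivity)]
                congr 1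
                rw [mul_pow]; field_simp
            _ ≤ _ := mul_le_mul_right (h _ hi1' _ hi2 hi5) _
      _ = ENNReal.ofReal (10 ^ (n - 1) / c) * ∑' i : u k, surf n (closedBall i.1.1 i.1.2) :=
          ENNReal.tsum_mul_left
      _ = ENNReal.ofReal (10 ^ (n - 1) / c) * surf n (⋃ i ∈ u k, closedBall i.1 i.2) := by
          rw [measure_biUnion (hcount k) (hud k) fun i _ => measurableSet_closedBall]
      _ ≤ _ := by
          gcongr
          exact iUnion₂_subset fun i hi => (hut k hi).2.2.2
  refine Measure.le_iff.2 fun s hs => ?_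
  rw [sphMeasure, Measure.restrict_apply hs, Measure.smul_apply, smul_eq_mul]
  refine ENNReal.le_of_forall_pos_le_add fun ε hε _ => ?_
  have hC' : ENNReal.ofReal (10 ^ (n - 1) / c) ≠ 0 := by simpa using hC
  obtain ⟨U, hsU, hU, hUlt⟩ := s.exists_isOpen_le_add (surf n)
    (ε := (ε : ℝ≥0∞) / ENNReal.ofReal (10 ^ (n - 1) / c))
    (ENNReal.div_pos (by simpa using hε.ne') ENNReal.ofReal_ne_top).ne'
  calc _ ≤ μH[(n : ℝ) - 1] (U ∩ unitSphere n) := measure_mono (inter_subset_inter_left _ hsU)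
    _ ≤ _ := hopen U hU
    _ ≤ ENNReal.ofReal (10 ^ (n - 1) / c) *
        (surf n s + (ε : ℝ≥0∞) / ENNReal.ofReal (10 ^ (n - 1) / c)) := by gcongr
    _ = _ := by rw [mul_add, ENNReal.mul_div_cancel hC' ENNReal.ofReal_ne_top]

/-- Area inequality: a differentiable map covering no point more than `N` times. -/
lemma lintegral_abs_det_mul_comp_le {n : ℕ} (hn : 1 ≤ n) {f : Vec n → Vec n} {E R : Set (Vec n)}
    (hE : MeasurableSet E) (hR : MeasurableSet R) (hf : ∀ x ∈ E, DifferentiableAt ℝ f x)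
    (hfR : MapsTo f E R) {N : ℝ≥0∞}
    (hN : ∀ y, (({x ∈ E | f x = y}).encard : ℝ≥0∞) ≤ N) {g : Vec n → ℝ≥0∞} (hg : Measurable g) :
    ∫⁻ x in E, ENNReal.ofReal |(fderiv ℝ f x).det| * g (f x) ≤ N * ∫⁻ y in R, g y := by
  have : NeZero n := ⟨by omega⟩
  have hdet : Measurable (fun x => (fderiv ℝ f x).det) :=
    ContinuousLinearMap.continuous_det.measurable.comp (measurable_fderiv ℝ f)
  set s : Set (Vec n) := E ∩ {x | (fderiv ℝ f x).det ≠ 0} with hs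
  have hsm : MeasurableSet s := hE.inter (hdet (measurableSet_singleton 0).compl)
  have hf' : ∀ x ∈ s, HasFDerivWithinAt f (fderiv ℝ f x) s x := fun x hx =>
    (hf x hx.1).hasFDerivAt.hasFDerivWithinAt
  let r : (Vec n →L[ℝ] Vec n) → ℝ≥0 := fun A =>
    if h : A.det ≠ 0 then
      ‖((A.toContinuousLinearEquivOfDetNeZero h).symm : Vec n →L[ℝ] Vec n)‖₊⁻¹ / 2 else 1
  have hrpos : ∀ A, r A ≠ 0 := by
    intro A
    simp only [r]
    split_ifs with h
    · have := (A.toContinuousLinearEquivOfDetNeZero h).nnnorm_symm_pos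
      positivity
    · exact one_ne_zero
  obtain ⟨t, A, htd, htm, hst, happ, hA⟩ :=
    exists_partition_approximatesLinearOn_of_hasFDerivWithinAt f s (fderiv ℝ f) hf' r hrpos
  have hinj : ∀ k, InjOn f (s ∩ t k) := by
    intro k
    by_cases hne : s.Nonempty
    · obtain ⟨y, hy, hAy⟩ := hA hne k
      have hd : (A k).det ≠ 0 := by rw [hAy]; exact hy.2
      have h1 := happ k
      have h2 : ApproximatesLinearOn f
          ((A k).toContinuousLinearEquivOfDetNeZero hd : Vec n →L[ℝ] Vec n) (s ∩ t k) (r (A k)) :=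
        h1
      refine h2.injOn (Or.inr ?_)
      simp only [r, dif_pos hd]
      have := ((A k).toContinuousLinearEquivOfDetNeZero hd).nnnorm_symm_pos
      exact half_lt_self (by positivity)
    · rw [not_nonempty_iff_eq_empty.1 hne]; simp
  have himg : ∀ k, MeasurableSet (f '' (s ∩ t k)) := fun k =>
    measurable_image_of_fderivWithin (hsm.inter (htm k))
      (fun x hx => (hf' x hx.1).mono inter_subset_left) (hinj k)
  have hcount : ∀ y, ∑' k, (f '' (s ∩ t k)).indicator (1 : Vec n → ℝ≥0∞) y ≤
      R.indicator (fun _ => N) y := by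
    intro y
    by_cases hy : y ∈ R
    · rw [indicator_of_mem hy]
      refine le_trans ?_ (hN y)
      have h1 : ∑' k, (f '' (s ∩ t k)).indicator (1 : Vec n → ℝ≥0∞) y =
          ∑' k, {k | y ∈ f '' (s ∩ t k)}.indicator (1 : ℕ → ℝ≥0∞) k := by
        apply tsum_congr; intro k; simp only [indicator, mem_ofPred_eq, Pi.one_apply]
      rw [h1, ← tsum_subtype]
      simp only [Pi.one_apply]
      rw [ENNReal.tsum_set_one]
      norm_cast
      have hch : ∀ k, ∃ x, k ∈ {k | y ∈ f '' (s ∩ t k)} → x ∈ s ∩ t k ∧ f x = y := by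
        intro k
        by_cases hk : k ∈ {k | y ∈ f '' (s ∩ t k)}
        · obtain ⟨x, hx, hxy⟩ := hk; exact ⟨x, fun _ => ⟨hx, hxy⟩⟩
        · exact ⟨0, fun h => absurd h hk⟩
      choose φ hφ using hch
      refine Set.encard_le_encard_of_injOn (f := φ) (fun k hk => ⟨(hφ k hk).1.1.1, (hφ k hk).2⟩) ?_
      intro k hk l hl hkl
      by_contra hne
      have h2 := (hφ k hk).1.2
      have h3 := (hφ l hl).1.2
      rw [← hkl] at h3
      exact disjoint_left.1 (htd hne) h2 h3
    · rw [indicator_of_notMem hy]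
      refine le_of_eq (ENNReal.tsum_eq_zero.2 fun k => indicator_of_notMem ?_ _)
      rintro ⟨x, hx, rfl⟩
      exact hy (hfR hx.1.1)
  calc ∫⁻ x in E, ENNReal.ofReal |(fderiv ℝ f x).det| * g (f x)
      ≤ ∫⁻ x in s, ENNReal.ofReal |(fderiv ℝ f x).det| * g (f x) := by
        rw [← lintegral_indicator hE, ← lintegral_indicator hsm]
        apply lintegral_mono
        intro x
        by_cases hx : x ∈ E
        · by_cases hd : (fderiv ℝ f x).det = 0
          · simp [hd, hx]
          · rw [indicator_of_mem hx, indicator_of_mem (show x ∈ s from ⟨hx, hd⟩)]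
        · simp [hx]
    _ ≤ ∫⁻ x in ⋃ k, s ∩ t k, ENNReal.ofReal |(fderiv ℝ f x).det| * g (f x) := by
        apply lintegral_mono_set
        rw [← inter_iUnion]
        exact subset_inter Subset.rfl hst
    _ ≤ ∑' k, ∫⁻ x in s ∩ t k, ENNReal.ofReal |(fderiv ℝ f x).det| * g (f x) :=
        lintegral_iUnion_le _ _
    _ = ∑' k, ∫⁻ y, (f '' (s ∩ t k)).indicator (1 : Vec n → ℝ≥0∞) y * g y := by
        apply tsum_congr; intro k
        rw [← lintegral_image_eq_lintegral_abs_det_fderiv_mul volume (hsm.inter (htm k))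
          (fun x hx => (hf' x hx.1).mono inter_subset_left) (hinj k),
          ← lintegral_indicator (himg k)]
        apply lintegral_congr; intro y
        by_cases hy : y ∈ f '' (s ∩ t k)
        · rw [indicator_of_mem hy, indicator_of_mem hy]; simp
        · rw [indicator_of_notMem hy, indicator_of_notMem hy]; simp
    _ = ∫⁻ y, ∑' k, (f '' (s ∩ t k)).indicator (1 : Vec n → ℝ≥0∞) y * g y := by
        rw [lintegral_tsum]
        exact fun k => ((measurable_one.indicator (himg k)).mul hg).aemeasurable
    _ ≤ ∫⁻ y, R.indicator (fun y => N * g y) y := by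
        apply lintegral_mono; intro y
        dsimp only
        rw [ENNReal.tsum_mul_right]
        refine (mul_le_mul_left (hcount y) _).trans (le_of_eq ?_)
        by_cases hy : y ∈ R <;> simp [hy]
    _ = _ := by
        rw [lintegral_indicator hR, lintegral_const_mul _ hg]

lemma lintegral_annulus {n : ℕ} (hn : 1 ≤ n) {m M : ℝ} (hm : 0 < m) (hmM : m ≤ M) :
    ∫⁻ y in {y : Vec n | ‖y‖ ∈ Icc m M}, ENNReal.ofReal ((‖y‖⁻¹) ^ n) =
      ENNReal.ofReal (Real.log (M / m)) * surf n univ := by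
  have hR : MeasurableSet {y : Vec n | ‖y‖ ∈ Icc m M} := measurable_norm measurableSet_Icc
  have hg : Measurable (fun y : Vec n => ENNReal.ofReal ((‖y‖⁻¹) ^ n)) := by fun_prop
  have hlog : ∫⁻ t in Icc m M, ENNReal.ofReal (t⁻¹) = ENNReal.ofReal (Real.log (M / m)) := by
    rw [← integral_inv_of_pos hm (hm.trans_le hmM), intervalIntegral.integral_of_le hmM,
      ← integral_Icc_eq_integral_Ioc, ofReal_integral_eq_lintegral_ofReal]
    · refine ContinuousOn.integrableOn_Icc ?_
      exact continuousOn_inv₀.mono fun t ht => (hm.trans_le ht.1).ne'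
    · filter_upwards [ae_restrict_mem measurableSet_Icc] with t ht
      exact inv_nonneg.2 (hm.le.trans ht.1)
  rw [← lintegral_indicator hR, lintegral_polar hn (hg.indicator hR), ← hlog,
    ← lintegral_const]
  apply lintegral_congr_ae
  filter_upwards [surf_ae_norm n] with ω hω
  rw [← lintegral_indicator measurableSet_Ioi, ← lintegral_indicator measurableSet_Icc]
  apply lintegral_congr
  intro t
  by_cases ht : t ∈ Icc m M
  · have ht0 : 0 < t := hm.trans_le ht.1
    have hn' : ‖t • ω‖ = t := by rw [norm_smul, hω, mul_one, Real.norm_of_nonneg ht0.le]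
    rw [indicator_of_mem (show t ∈ Ioi (0 : ℝ) from ht0), indicator_of_mem ht,
      indicator_of_mem (by simpa [hn'] using ht), hn', ← ENNReal.ofReal_mul (by positivity)]
    congr 1
    obtain ⟨k, rfl⟩ : ∃ k, n = k + 1 := ⟨n - 1, by omega⟩
    simp only [Nat.add_sub_cancel, inv_pow, pow_succ]
    field_simp
  · rw [indicator_of_notMem ht]
    by_cases ht0 : t ∈ Ioi (0 : ℝ)
    · have ht0' : 0 < t := ht0
      have hn' : ‖t • ω‖ = t := by rw [norm_smul, hω, mul_one, Real.norm_of_nonneg ht0'.le]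
      rw [indicator_of_mem ht0, indicator_of_notMem (by simpa [hn'] using ht), mul_zero]
    · rw [indicator_of_notMem ht0]

/-- Energy of `log ‖f‖` for a quasiregular map on a set where the multiplicity and the
oscillation are bounded. -/
lemma IsQR.lintegral_energy_le {n : ℕ} (hn : 1 ≤ n) {K : ℝ} {f : Vec n → Vec n} (hf : IsQR n K f)
    (hK : 1 ≤ K) {E : Set (Vec n)} (hE : MeasurableSet E) (hEB : E ⊆ unitBall n) {m M : ℝ}
    (hm : 0 < m) (hmM : m ≤ M) (hfE : ∀ x ∈ E, ‖f x‖ ∈ Icc m M) {N : ℝ≥0∞}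
    (hN : ∀ y, (({x ∈ E | f x = y}).encard : ℝ≥0∞) ≤ N) :
    ∫⁻ x in E, ENNReal.ofReal ((‖fderiv ℝ f x‖ / ‖f x‖) ^ n) ≤
      ENNReal.ofReal K * (N * (ENNReal.ofReal (Real.log (M / m)) * surf n univ)) := by
  have hg : Measurable (fun y : Vec n => ENNReal.ofReal ((‖y‖⁻¹) ^ n)) := by fun_prop
  have hR : MeasurableSet {y : Vec n | ‖y‖ ∈ Icc m M} := measurable_norm measurableSet_Icc
  have h1 := lintegral_abs_det_mul_comp_le hn hE hR (fun x hx => hf.2.1 x (hEB hx)) hfE hN hg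
  rw [lintegral_annulus hn hm hmM] at h1
  refine le_trans ?_ (mul_le_mul_right h1 _)
  rw [← lintegral_const_mul' _ _ ENNReal.ofReal_ne_top]
  apply lintegral_mono_ae
  filter_upwards [ae_restrict_of_ae_restrict_of_subset hEB hf.2.2] with x hx
  rw [← ENNReal.ofReal_mul (abs_nonneg _), ← ENNReal.ofReal_mul (by linarith)]
  apply ENNReal.ofReal_le_ofReal
  rw [div_eq_mul_inv, mul_pow, ← mul_assoc]
  gcongr
  exact hx.trans (by gcongr; exact le_abs_self _)

lemma mobiusT_eq {n : ℕ} (x y : Vec n) :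
    mobiusT n x y = (‖x‖ ^ 2 * ‖y‖ ^ 2 - 2 * inner ℝ x y + 1)⁻¹ •
      ((1 - ‖x‖ ^ 2) • y - (1 + ‖y‖ ^ 2 - 2 * inner ℝ x y) • x) := by
  unfold mobiusT
  split_ifs with hx
  · simp [hx]
  · have hx' : ‖x‖ ≠ 0 := norm_ne_zero_iff.2 hx
    have h1 : ‖x‖ ^ 2 * ‖y - (‖x‖ ^ 2)⁻¹ • x‖ ^ 2 =
        ‖x‖ ^ 2 * ‖y‖ ^ 2 - 2 * inner ℝ x y + 1 := by
      rw [norm_sub_sq_real, inner_smul_right, norm_smul, real_inner_comm, Real.norm_eq_abs, mul_pow,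
        sq_abs]
      field_simp
    rw [h1, norm_sub_sq_real, real_inner_comm]
    congr 1
    module

/-- Every `z` in the ball is the image of a point whose distance to the sphere is explicit. -/
lemma exists_mobiusT_eq {n : ℕ} {x z : Vec n} (hx : ‖x‖ < 1) (hz : ‖z‖ < 1) :
    ∃ y : Vec n, mobiusT n (-x) y = z ∧ (1 - ‖y‖ ^ 2) * (‖x - z‖ ^ 2 +
      (1 - ‖x‖ ^ 2) * (1 - ‖z‖ ^ 2)) = (1 - ‖x‖ ^ 2) * (1 - ‖z‖ ^ 2) := by
  have hs : 0 < 1 - ‖x‖ ^ 2 := by nlinarith [norm_nonneg x]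
  have hq : 0 < 1 - ‖z‖ ^ 2 := by nlinarith [norm_nonneg z]
  set s := ‖x‖ ^ 2 with hsdef
  set q := ‖z‖ ^ 2 with hqdef
  set b : ℝ := inner ℝ x z with hb
  have hxz : ‖x - z‖ ^ 2 = s - 2 * b + q := by rw [norm_sub_sq_real]
  set D : ℝ := s * q - 2 * b + 1 with hD
  have hDeq : ‖x - z‖ ^ 2 + (1 - s) * (1 - q) = D := by rw [hxz, hD]; ring
  have hDpos : 0 < D := by rw [← hDeq]; positivity
  set y := mobiusT n x z with hy
  rw [mobiusT_eq, ← hsdef, ← hqdef, ← hb, ← hD] at hy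
  have hyn : ‖y‖ ^ 2 = ((1 - s) ^ 2 * q - 2 * (1 - s) * (1 + q - 2 * b) * b +
      (1 + q - 2 * b) ^ 2 * s) / D ^ 2 := by
    rw [hy, norm_smul, mul_pow, norm_sub_sq_real, norm_smul, norm_smul, inner_smul_left,
      inner_smul_right, real_inner_comm x z, ← hb]
    simp only [Real.norm_eq_abs, mul_pow, sq_abs, ← hsdef, ← hqdef, conj_trivial]
    field_simp
  refine ⟨y, ?_, ?_⟩
  · have hxy : inner ℝ x y = ((1 - s) * b - (1 + q - 2 * b) * s) / D := by
      rw [hy, inner_smul_right, inner_sub_right, inner_smul_right, inner_smul_right, ← hb,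
        real_inner_self_eq_norm_sq, ← hsdef]
      field_simp
    have hD' : s * ‖y‖ ^ 2 + 2 * inner ℝ x y + 1 = (1 - s) ^ 2 / D := by
      rw [hyn, hxy]; field_simp; rw [hD]; ring
    have hN' : 1 + ‖y‖ ^ 2 + 2 * inner ℝ x y = (1 - s) * (1 + q - 2 * b) / D := by
      rw [hyn, hxy]; field_simp; rw [hD]; ring
    rw [mobiusT_eq, norm_neg, inner_neg_left, ← hsdef]
    have e1 : s * ‖y‖ ^ 2 - 2 * -inner ℝ x y + 1 = (1 - s) ^ 2 / D := by rw [← hD']; ring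
    have e2 : 1 + ‖y‖ ^ 2 - 2 * -inner ℝ x y = (1 - s) * (1 + q - 2 * b) / D := by
      rw [← hN']; ring
    rw [e1, e2, hy]
    have e3 : ∀ (u v : ℝ), ((1 - s) ^ 2 / D)⁻¹ • ((1 - s) • D⁻¹ • ((1 - s) • z - u • x) -
        (v) • -x) = (((1 - s) ^ 2 / D)⁻¹ * ((1 - s) * D⁻¹ * (1 - s))) • z +
        (((1 - s) ^ 2 / D)⁻¹ * (v - (1 - s) * D⁻¹ * u)) • x := by
      intro u v; module
    rw [e3]
    have e4 : ((1 - s) ^ 2 / D)⁻¹ * ((1 - s) * D⁻¹ * (1 - s)) = 1 := by field_simp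
    have e5 : (1 - s) * (1 + q - 2 * b) / D - (1 - s) * D⁻¹ * (1 + q - 2 * b) = 0 := by
      field_simp; ring
    rw [e4, e5]; simp
  · rw [hDeq, hyn]; field_simp; rw [hD]; ring

/-- The arithmetic behind `exists_mobiusT_eq_of_mem_box`. -/
lemma le_of_mobius_identity {r ε y z d : ℝ} (hr : 0 < r) (hr1 : r ≤ 1) (hε : 0 < ε) (hz : z < 1)
    (hz0 : 0 ≤ z) (hz5 : 1 - z ≤ 5 * r) (hy0 : 0 ≤ y) (hd0 : 0 ≤ d) (hzε : ε * r ≤ 1 - z)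
    (hd : d ≤ 6 * r) (hyz : (1 - y ^ 2) * (d ^ 2 + (1 - (1 - r) ^ 2) * (1 - z ^ 2)) =
      (1 - (1 - r) ^ 2) * (1 - z ^ 2)) : y ≤ 1 - ε / 112 := by
  have h1 : d ^ 2 ≤ 36 * r ^ 2 := by
    calc d ^ 2 ≤ (6 * r) ^ 2 := by gcongr
      _ = _ := by ring
  have hεr : 0 < ε * r ^ 2 := by positivity
  have e1 : 1 - (1 - r) ^ 2 ≤ 2 * r := by
    linarith [sq_nonneg r, (by ring : 1 - (1 - r) ^ 2 = 2 * r - r ^ 2)]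
  have e1' : r ≤ 1 - (1 - r) ^ 2 := by
    linarith [mul_nonneg hr.le (sub_nonneg.2 hr1), (by ring : 1 - (1 - r) ^ 2 = r + r * (1 - r))]
  have hz2 : 1 - z ^ 2 = (1 - z) + z * (1 - z) := by ring
  have hz3 : z * (1 - z) ≤ 1 * (1 - z) := by gcongr
  have hz4 : 0 ≤ z * (1 - z) := mul_nonneg hz0 (by linarith)
  have e2 : 1 - z ^ 2 ≤ 10 * r := by linarith
  have e2' : ε * r ≤ 1 - z ^ 2 := by linarith
  have e3 : 0 ≤ 1 - z ^ 2 := by linarith [mul_pos hε hr]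
  generalize (1 - (1 - r) ^ 2) = A at *
  generalize 1 - z ^ 2 = B at *
  have hA0 : 0 ≤ A := hr.le.trans e1'
  have h2 : A * B ≤ 20 * r ^ 2 := by
    calc A * B ≤ 2 * r * (10 * r) := by gcongr
      _ = _ := by ring
  have h3 : ε * r ^ 2 ≤ A * B := by
    calc ε * r ^ 2 = r * (ε * r) := by ring
      _ ≤ A * B := by gcongr
  have hD : 0 < d ^ 2 + A * B := by linarith [sq_nonneg d]
  have h4 : 0 < 1 - y ^ 2 := by
    by_contra hcon
    have : A * B ≤ 0 := by
      rw [← hyz]; exact mul_nonpos_of_nonpos_of_nonneg (not_lt.1 hcon) hD.le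
    linarith
  have h5 : ε * r ^ 2 ≤ ((1 - y ^ 2) * 56) * r ^ 2 := by
    calc ε * r ^ 2 ≤ A * B := h3
      _ = (1 - y ^ 2) * (d ^ 2 + A * B) := hyz.symm
      _ ≤ (1 - y ^ 2) * (56 * r ^ 2) := by gcongr; linarith
      _ = _ := by ring
  have h6 : ε ≤ (1 - y ^ 2) * 56 := le_of_mul_le_mul_right h5 (by positivity)
  have h7 : y < 1 := by
    rw [← abs_of_nonneg hy0]
    exact (sq_lt_one_iff_abs_lt_one y).1 (by linarith)
  have h8 : y * (1 - y) ≤ 1 * (1 - y) := by gcongr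
  linarith [(by ring : 1 - y ^ 2 = (1 - y) + y * (1 - y))]

/-- Points of the box of size `r` at `ω` whose distance to the sphere is at least `ε * r` are images
of a fixed ball under the automorphism centred at `(1 - r) • ω`. -/
lemma exists_mobiusT_eq_of_mem_box {n : ℕ} {ω z : Vec n} {r ε : ℝ} (hω : ‖ω‖ = 1) (hr : 0 < r)
    (hr1 : r ≤ 1) (hε : 0 < ε) (hz : ‖z‖ < 1) (hzω : ‖z - ω‖ ≤ 5 * r)
    (hzε : ε * r ≤ 1 - ‖z‖) :
    ∃ y : Vec n, mobiusT n (-((1 - r) • ω)) y = z ∧ ‖y‖ ≤ 1 - ε / 112 := by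
  have hx : ‖(1 - r) • ω‖ = 1 - r := by
    rw [norm_smul, hω, mul_one, Real.norm_of_nonneg (by linarith)]
  obtain ⟨y, hy, hyz⟩ := exists_mobiusT_eq (x := (1 - r) • ω) (z := z) (by rw [hx]; linarith) hz
  refine ⟨y, hy, ?_⟩
  have hd : ‖(1 - r) • ω - z‖ ≤ 6 * r := by
    calc ‖(1 - r) • ω - z‖ = ‖-(r • ω) - (z - ω)‖ := by congr 1; module
      _ ≤ ‖-(r • ω)‖ + ‖z - ω‖ := norm_sub_le _ _
      _ ≤ r + 5 * r := by
        rw [norm_neg, norm_smul, hω, mul_one, Real.norm_of_nonneg hr.le]; gcongr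
      _ = 6 * r := by ring
  have hz5 : 1 - ‖z‖ ≤ 5 * r := by
    have := norm_sub_norm_le ω z
    rw [hω, norm_sub_rev] at this; linarith
  rw [hx] at hyz
  exact le_of_mobius_identity hr hr1 hε hz (norm_nonneg z) hz5 (norm_nonneg _) (norm_nonneg _) hzε
    hd hyz

lemma mobiusT_neg_zero {n : ℕ} (x : Vec n) : mobiusT n (-x) 0 = x := by
  rw [mobiusT_eq]; simp

/-- The part of the box of size `r` at `ω` at distance at least `ε * r` from the sphere. -/
def boxCore (n : ℕ) (ω : Vec n) (r ε : ℝ) : Set (Vec n) :=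
  {z ∈ unitBall n | ‖z - ω‖ ≤ 5 * r ∧ ε * r ≤ 1 - ‖z‖}

lemma measurableSet_unitBall (n : ℕ) : MeasurableSet (unitBall n) := measurableSet_ball

lemma mem_unitBall {n : ℕ} {x : Vec n} : x ∈ unitBall n ↔ ‖x‖ < 1 := mem_ball_zero_iff

lemma measurableSet_boxCore (n : ℕ) (ω : Vec n) (r ε : ℝ) : MeasurableSet (boxCore n ω r ε) := by
  have h1 : MeasurableSet {z : Vec n | ‖z - ω‖ ≤ 5 * r} :=
    measurableSet_le (by fun_prop) (by fun_prop)
  have h2 : MeasurableSet {z : Vec n | ε * r ≤ 1 - ‖z‖} :=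
    measurableSet_le (by fun_prop) (by fun_prop)
  exact (measurableSet_unitBall n).inter (h1.inter h2)

/-- A Harnack inequality on box cores. -/
lemma InMiniowitz.harnack {n : ℕ} {C₀ α : ℝ} {f : Vec n → Vec n} (hMin : InMiniowitz n C₀ α f)
    (hC₀ : 1 ≤ C₀) (hα : 0 < α) (hf0 : ∀ x ∈ unitBall n, f x ≠ 0) {ω z : Vec n} {r ε : ℝ}
    (hω : ‖ω‖ = 1) (hr : 0 < r) (hr1 : r ≤ 1) (hε : 0 < ε)
    (hz : z ∈ boxCore n ω r ε) :
    ‖f z‖ ≤ C₀ * (224 / ε) ^ α * ‖f ((1 - r) • ω)‖ ∧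
      ‖f ((1 - r) • ω)‖ ≤ C₀ * (224 / ε) ^ α * ‖f z‖ := by
  obtain ⟨hzB, hzω, hzε⟩ := hz
  obtain ⟨y, hy, hyε⟩ := exists_mobiusT_eq_of_mem_box hω hr hr1 hε (mem_unitBall.1 hzB) hzω hzε
  have hx : (1 - r) • ω ∈ unitBall n := by
    rw [mem_unitBall, norm_smul, hω, mul_one, Real.norm_of_nonneg (by linarith)]; linarith
  have hy0 := norm_nonneg y
  have hyB : y ∈ unitBall n := by rw [mem_unitBall]; linarith
  obtain ⟨h1, h2⟩ := hMin _ hx y hyB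
  rw [mobiusT_neg_zero, hy] at h1 h2
  have hfx : 0 < ‖f ((1 - r) • ω)‖ := norm_pos_iff.2 (hf0 _ hx)
  have hq : (1 + ‖y‖) / (1 - ‖y‖) ≤ 224 / ε := by
    rw [div_le_div_iff₀ (by linarith) hε]; nlinarith
  have hq0 : 0 < (1 + ‖y‖) / (1 - ‖y‖) := div_pos (by linarith) (by linarith)
  have hqα : ((1 + ‖y‖) / (1 - ‖y‖)) ^ α ≤ (224 / ε) ^ α :=
    Real.rpow_le_rpow hq0.le hq hα.le
  have hC : (0 : ℝ) < C₀ := by linarith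
  constructor
  · rw [div_le_iff₀ hfx] at h2
    exact h2.trans (by gcongr)
  · rw [le_div_iff₀ hfx, ← inv_div (1 + ‖y‖), Real.inv_rpow hq0.le, ← mul_inv,
      inv_mul_le_iff₀ (by positivity)] at h1
    exact h1.trans (by gcongr)

/-- The multiplicity of `f` on a box core. -/
lemma MultCond.encard_le {n : ℕ} {a C₁ : ℝ} {f : Vec n → Vec n} (hM : MultCond n a C₁ f)
    {ω : Vec n} {r ε : ℝ} (hω : ‖ω‖ = 1) (hr : 0 < r) (hr1 : r ≤ 1) (hε : 0 < ε) (hε1 : ε ≤ 1)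
    (y : Vec n) :
    (({x ∈ boxCore n ω r ε | f x = y}).encard : ℝ≥0∞) ≤ ENNReal.ofReal (C₁ / (ε / 200) ^ a) := by
  have hx : (1 - r) • ω ∈ unitBall n := by
    rw [mem_unitBall, norm_smul, hω, mul_one, Real.norm_of_nonneg (by linarith)]; linarith
  have := hM _ hx (1 - ε / 200) (by linarith) (by linarith) y
  rw [sub_sub_cancel] at this
  refine le_trans ?_ this
  have hsub : {x ∈ boxCore n ω r ε | f x = y} ⊆ mobiusT n (-((1 - r) • ω)) ''
      {z ∈ Metric.ball (0 : Vec n) (1 - ε / 200) | f (mobiusT n (-((1 - r) • ω)) z) = y} := by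
    rintro z ⟨⟨hzB, hzω, hzε⟩, hz⟩
    obtain ⟨u, hu, huε⟩ := exists_mobiusT_eq_of_mem_box hω hr hr1 hε (mem_unitBall.1 hzB) hzω hzε
    refine ⟨u, ⟨?_, by rw [hu]; exact hz⟩, hu⟩
    rw [mem_ball_zero_iff]; linarith
  have h := (Set.encard_le_encard hsub).trans (Set.encard_image_le _ _)
  exact_mod_cast h

/-- The conformal energy of `log ‖f‖` on a box core. -/
lemma exists_energy_boxCore_le {n : ℕ} (hn : 1 ≤ n) {K C₀ α a b C₁ : ℝ} (hK : 1 ≤ K)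
    (hC₀ : 1 ≤ C₀) (hα : 0 < α) (ha0 : 0 ≤ a) (hab : a < b) (hC₁ : 0 < C₁)
    {f : Vec n → Vec n} (hf : IsQR n K f) (hf0 : ∀ x ∈ unitBall n, f x ≠ 0)
    (hMin : InMiniowitz n C₀ α f) (hM : MultCond n a C₁ f) :
    ∃ C : ℝ, 0 < C ∧ ∀ ω : Vec n, ‖ω‖ = 1 → ∀ r : ℝ, 0 < r → r ≤ 1 → ∀ ε : ℝ, 0 < ε → ε ≤ 1 →
      ∫⁻ x in boxCore n ω r ε, ENNReal.ofReal ((‖fderiv ℝ f x‖ / ‖f x‖) ^ n) ≤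
        ENNReal.ofReal (C * (1 / ε) ^ b) := by
  set δ : ℝ := (b - a) / (2 * α) with hδ
  have hδ0 : 0 < δ := div_pos (by linarith) (by linarith)
  set S : ℝ := (surf n univ).toReal
  refine ⟨K * (C₁ * (C₀ ^ (2 * δ) / δ) * 224 ^ b * (S + 1)), by positivity, ?_⟩
  intro ω hω r hr hr1 ε hε hε1
  have hx : (1 - r) • ω ∈ unitBall n := by
    rw [mem_unitBall, norm_smul, hω, mul_one, Real.norm_of_nonneg (by linarith)]; linarith
  have hfx : 0 < ‖f ((1 - r) • ω)‖ := norm_pos_iff.2 (hf0 _ hx)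
  set F := ‖f ((1 - r) • ω)‖
  set L := C₀ * (224 / ε) ^ α with hL
  have h224 : 1 ≤ 224 / ε := by rw [le_div_iff₀ hε]; linarith
  have hL1 : 1 ≤ L := by
    have : 1 ≤ (224 / ε) ^ α := Real.one_le_rpow h224 hα.le
    rw [hL]; nlinarith
  have hE : ∀ x ∈ boxCore n ω r ε, ‖f x‖ ∈ Icc (F / L) (L * F) := by
    intro x hx
    obtain ⟨h1, h2⟩ := hMin.harnack hC₀ hα hf0 hω hr hr1 hε hx
    exact ⟨by rw [div_le_iff₀ (by linarith)]; linarith [h2, mul_comm L ‖f x‖], h1⟩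
  have hmM : F / L ≤ L * F := by
    rw [div_le_iff₀ (by linarith)]
    nlinarith [mul_pos hfx (by linarith : 0 < L)]
  have := hf.lintegral_energy_le hn hK (measurableSet_boxCore n ω r ε) (fun x hx ↦ hx.1)
    (div_pos hfx (by linarith)) hmM hE (hM.encard_le hω hr hr1 hε hε1)
  refine this.trans ?_
  have hlog : Real.log (L * F / (F / L)) ≤ C₀ ^ (2 * δ) / δ * (224 / ε) ^ (b - a) := by
    have e : L * F / (F / L) = L ^ (2 : ℝ) := by
      rw [Real.rpow_two]; field_simp
    rw [e]
    refine (Real.log_le_rpow_div (by positivity) hδ0).trans (le_of_eq ?_)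
    rw [← Real.rpow_mul (by linarith), hL, Real.mul_rpow (by linarith) (by positivity),
      ← Real.rpow_mul (by positivity)]
    have : α * (2 * δ) = b - a := by rw [hδ]; field_simp
    rw [this]; ring
  have hN : C₁ / (ε / 200) ^ a ≤ C₁ * (224 / ε) ^ a := by
    rw [div_eq_mul_inv, ← Real.inv_rpow (by positivity), inv_div]
    gcongr
    norm_num
  have hS : surf n univ ≤ ENNReal.ofReal (S + 1) := by
    rw [← ENNReal.ofReal_toReal (measure_ne_top (surf n) univ)]
    exact ENNReal.ofReal_le_ofReal (by linarith)
  calc _ ≤ ENNReal.ofReal K * (ENNReal.ofReal (C₁ * (224 / ε) ^ a) *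
        (ENNReal.ofReal (C₀ ^ (2 * δ) / δ * (224 / ε) ^ (b - a)) * ENNReal.ofReal (S + 1))) := by
        gcongr
    _ = ENNReal.ofReal (K * (C₁ * (224 / ε) ^ a *
        (C₀ ^ (2 * δ) / δ * (224 / ε) ^ (b - a) * (S + 1)))) := by
        rw [← ENNReal.ofReal_mul (by positivity), ← ENNReal.ofReal_mul (by positivity),
          ← ENNReal.ofReal_mul (by positivity)]
    _ = _ := by
        congr 1
        have e : (224 / ε) ^ a * (224 / ε) ^ (b - a) = 224 ^ b * (1 / ε) ^ b := by
          rw [← Real.rpow_add (by positivity), ← Real.mul_rpow (by positivity) (by positivity)]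
          congr 1
          · ring
          · ring
        calc _ = K * (C₁ * (C₀ ^ (2 * δ) / δ) * ((224 / ε) ^ a * (224 / ε) ^ (b - a)) *
              (S + 1)) := by ring
          _ = _ := by rw [e]; ring

lemma le_pow_mul_add_inv {n : ℕ} (hn : 1 ≤ n) {g s : ℝ} (hg : 0 ≤ g) (hs : 0 < s) :
    g ≤ s ^ (n - 1) * g ^ n + s⁻¹ := by
  obtain ⟨m, rfl⟩ : ∃ m, n = m + 1 := ⟨n - 1, by omega⟩
  rw [Nat.add_sub_cancel]
  rcases le_total g s⁻¹ with h | h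
  · have : 0 ≤ s ^ m * g ^ (m + 1) := by positivity
    linarith
  · have h1 : 1 ≤ s * g := by
      have := mul_le_mul_of_nonneg_left h hs.le
      rwa [mul_inv_cancel₀ hs.ne'] at this
    have h2 : 1 ≤ (s * g) ^ m := one_le_pow₀ h1
    have h3 : s ^ m * g ^ (m + 1) = (s * g) ^ m * g := by ring
    rw [h3]
    have : 0 < s⁻¹ := inv_pos.2 hs
    nlinarith

lemma lintegral_ofReal_le_pow_add {n : ℕ} (hn : 1 ≤ n) {X : Type*} [MeasurableSpace X]
    {μ : Measure X} {g : X → ℝ} (hg : ∀ x, 0 ≤ g x) {s : ℝ} (hs : 0 < s) (E : Set X) :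
    ∫⁻ x in E, ENNReal.ofReal (g x) ∂μ ≤ ENNReal.ofReal (s ^ (n - 1)) *
      ∫⁻ x in E, ENNReal.ofReal (g x ^ n) ∂μ + ENNReal.ofReal s⁻¹ * μ E := by
  calc ∫⁻ x in E, ENNReal.ofReal (g x) ∂μ
      ≤ ∫⁻ x in E, (ENNReal.ofReal (s ^ (n - 1)) * ENNReal.ofReal (g x ^ n) +
          ENNReal.ofReal s⁻¹) ∂μ := by
        refine lintegral_mono fun x ↦ ?_
        rw [← ENNReal.ofReal_mul (by positivity), ← ENNReal.ofReal_add
          (mul_nonneg (by positivity) (pow_nonneg (hg x) _)) (by positivity)]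
        exact ENNReal.ofReal_le_ofReal (le_pow_mul_add_inv hn (hg x) hs)
    _ = _ := by
        rw [lintegral_add_right _ measurable_const, lintegral_const_mul' _ _ ENNReal.ofReal_ne_top]
        simp

/-- The Carleson estimate for the logarithmic derivative. -/
lemma exists_carleson_le {n : ℕ} (hn : 2 ≤ n) {K C₀ α a C₁ : ℝ} (hK : 1 ≤ K)
    (hC₀ : 1 ≤ C₀) (hα : 0 < α) (ha0 : 0 ≤ a) (ha : a < (n : ℝ) - 1) (hC₁ : 0 < C₁)
    {f : Vec n → Vec n} (hf : IsQR n K f) (hf0 : ∀ x ∈ unitBall n, f x ≠ 0)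
    (hMin : InMiniowitz n C₀ α f) (hM : MultCond n a C₁ f) :
    ∃ C : ℝ, 0 < C ∧ ∀ ω : Vec n, ‖ω‖ = 1 → ∀ r : ℝ, 0 < r → r ≤ 1 →
      ∫⁻ x in {z ∈ unitBall n | ‖z - ω‖ ≤ 5 * r}, ENNReal.ofReal (‖fderiv ℝ f x‖ / ‖f x‖) ≤
        ENNReal.ofReal (C * r ^ (n - 1)) := by
  obtain ⟨b, hab, hb⟩ := exists_between ha
  obtain ⟨A, hA, hAle⟩ := exists_energy_boxCore_le (by omega : 1 ≤ n) hK hC₀ hα ha0 hab hC₁ hf hf0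
    hMin hM
  obtain ⟨V, hV, hVle⟩ := exists_volume_shell_le (by omega : 1 ≤ n)
  have hm : (0 : ℝ) < (n : ℝ) - 1 := by linarith
  set θ : ℝ := (b / ((n : ℝ) - 1) + 1) / 2 with hθ
  have hθ1 : θ < 1 := by
    have : b / ((n : ℝ) - 1) < 1 := (div_lt_one hm).2 hb
    rw [hθ]; linarith
  set τ : ℝ := 2 ^ (-θ) with hτ
  have hτ0 : 0 < τ := by positivity
  set q₁ : ℝ := τ ^ (n - 1) * 2 ^ b with hq₁
  set q₂ : ℝ := τ⁻¹ * (1 / 2) with hq₂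
  have hq₁0 : 0 < q₁ := by positivity
  have hq₂0 : 0 < q₂ := by positivity
  have hq₁1 : q₁ < 1 := by
    have : q₁ = 2 ^ ((b - ((n : ℝ) - 1)) / 2) := by
      rw [hq₁, hτ, ← Real.rpow_natCast, ← Real.rpow_mul (by norm_num),
        ← Real.rpow_add (by norm_num)]
      congr 1
      rw [Nat.cast_sub (by omega), Nat.cast_one, hθ]
      field_simp
      ring
    rw [this]
    exact Real.rpow_lt_one_of_one_lt_of_neg (by norm_num) (by linarith)
  have hq₂1 : q₂ < 1 := by
    have h1 : (2 : ℝ) ^ θ < 2 ^ (1 : ℝ) := Real.rpow_lt_rpow_of_exponent_lt (by norm_num) hθ1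
    rw [hq₂, hτ, Real.rpow_neg (by norm_num), inv_inv]
    rw [Real.rpow_one] at h1
    linarith
  set g : Vec n → ℝ := fun x ↦ ‖fderiv ℝ f x‖ / ‖f x‖
  have hg : ∀ x, 0 ≤ g x := fun x ↦ by positivity
  refine ⟨A * (1 - q₁)⁻¹ + 5 * V * 5 ^ (n - 1) * (1 - q₂)⁻¹, by
    have := sub_pos.2 hq₁1; have := sub_pos.2 hq₂1; positivity, ?_⟩
  intro ω hω r hr hr1
  set Lay : ℕ → Set (Vec n) := fun j ↦ {z ∈ boxCore n ω r ((1 / 2) ^ j) |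
    1 - 5 * (1 / 2) ^ j * r ≤ ‖z‖} with hLay
  have hcover : {z ∈ unitBall n | ‖z - ω‖ ≤ 5 * r} ⊆ ⋃ j, Lay j := by
    rintro z ⟨hzB, hzω⟩
    have hz1 := mem_unitBall.1 hzB
    have hz5 : 1 - ‖z‖ ≤ 5 * r := by
      have := norm_sub_norm_le ω z
      rw [hω, norm_sub_rev] at this; linarith
    rw [mem_iUnion]
    rcases le_or_gt r (1 - ‖z‖) with h | h
    · exact ⟨0, ⟨hzB, hzω, by simpa using h⟩, by simp; linarith⟩
    · have ht0 : 0 < (1 - ‖z‖) / r := div_pos (by linarith) hr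
      obtain ⟨k, hk1, hk2⟩ := exists_nat_pow_near_of_lt_one ht0 ((div_le_one hr).2 h.le)
        (by norm_num : (0 : ℝ) < 1 / 2) (by norm_num)
      rw [lt_div_iff₀ hr] at hk1
      rw [div_le_iff₀ hr] at hk2
      refine ⟨k + 1, ⟨hzB, hzω, hk1.le⟩, ?_⟩
      have : 0 < (1 / 2 : ℝ) ^ k * r := by positivity
      rw [pow_succ]; linarith
  have hlay : ∀ j, ∫⁻ x in Lay j, ENNReal.ofReal (g x) ≤ ENNReal.ofReal
      (A * r ^ (n - 1) * q₁ ^ j) + ENNReal.ofReal (5 * V * 5 ^ (n - 1) * r ^ (n - 1) * q₂ ^ j) := by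
    intro j
    have hs : 0 < r * τ ^ j := by positivity
    have hj1 : ((1 / 2 : ℝ)) ^ j ≤ 1 := pow_le_one₀ (by norm_num) (by norm_num)
    have h2j : (0 : ℝ) < (1 / 2) ^ j := by positivity
    refine (lintegral_ofReal_le_pow_add (by omega : 1 ≤ n) hg hs _).trans (add_le_add ?_ ?_)
    · calc _ ≤ ENNReal.ofReal ((r * τ ^ j) ^ (n - 1)) *
            ENNReal.ofReal (A * (1 / (1 / 2) ^ j) ^ b) := by
            gcongr
            exact (lintegral_mono_set (fun z hz ↦ hz.1)).trans
              (hAle ω hω r hr hr1 _ h2j hj1)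
        _ = _ := by
            rw [← ENNReal.ofReal_mul (by positivity)]
            congr 1
            have e : (1 / (1 / 2 : ℝ) ^ j) ^ b = (2 ^ b) ^ j := by
              rw [one_div, ← inv_pow, one_div, inv_inv, ← Real.rpow_natCast, ← Real.rpow_natCast,
                ← Real.rpow_mul (by norm_num), ← Real.rpow_mul (by norm_num), mul_comm]
            rw [e, hq₁, mul_pow, mul_pow, ← pow_mul, ← pow_mul, mul_comm j (n - 1)]
            ring
    · have hsub : Lay j ⊆ {z ∈ unitBall n | ‖z - ω‖ ≤ 5 * (5 * r) ∧
          1 - 5 * (1 / 2) ^ j * r ≤ ‖z‖} := by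
        rintro z ⟨⟨hzB, hzω, -⟩, hz⟩
        exact ⟨hzB, by linarith, hz⟩
      calc _ ≤ ENNReal.ofReal (r * τ ^ j)⁻¹ *
            ENNReal.ofReal (V * (5 * (1 / 2) ^ j * r) * (5 * r) ^ (n - 1)) := by
            gcongr
            refine (measure_mono hsub).trans
              (hVle ω hω (5 * r) (by positivity) _ (by positivity) ?_)
            nlinarith
        _ = _ := by
            rw [← ENNReal.ofReal_mul (by positivity)]
            congr 1
            rw [hq₂, mul_pow, mul_pow, inv_pow]
            field_simp
  calc _ ≤ ∫⁻ x in ⋃ j, Lay j, ENNReal.ofReal (g x) := lintegral_mono_set hcover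
    _ ≤ ∑' j, ∫⁻ x in Lay j, ENNReal.ofReal (g x) := lintegral_iUnion_le _ _
    _ ≤ ∑' j, (ENNReal.ofReal (A * r ^ (n - 1) * q₁ ^ j) +
          ENNReal.ofReal (5 * V * 5 ^ (n - 1) * r ^ (n - 1) * q₂ ^ j)) :=
        ENNReal.tsum_le_tsum hlay
    _ = ENNReal.ofReal (∑' j, A * r ^ (n - 1) * q₁ ^ j) +
          ENNReal.ofReal (∑' j, 5 * V * 5 ^ (n - 1) * r ^ (n - 1) * q₂ ^ j) := by
        rw [ENNReal.tsum_add, ENNReal.ofReal_tsum_of_nonneg, ENNReal.ofReal_tsum_of_nonneg]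
        · intro j; positivity
        · exact (summable_geometric_of_lt_one hq₂0.le hq₂1).mul_left _
        · intro j; positivity
        · exact (summable_geometric_of_lt_one hq₁0.le hq₁1).mul_left _
    _ = _ := by
        have := sub_pos.2 hq₁1
        have := sub_pos.2 hq₂1
        rw [tsum_mul_left, tsum_mul_left, tsum_geometric_of_lt_one hq₁0.le hq₁1,
          tsum_geometric_of_lt_one hq₂0.le hq₂1, ← ENNReal.ofReal_add (by positivity)
          (by positivity)]
        congr 1
        ring

/-- The weighted integral of `H` along the ray through `ζ`, as in polar coordinates. -/
def rayInt (n : ℕ) (H : Vec n → ℝ≥0∞) (ζ : Vec n) : ℝ≥0∞ :=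
  ∫⁻ t in Ioi (0 : ℝ), ENNReal.ofReal (t ^ (n - 1)) * H (t • ζ)

lemma measurable_rayInt {n : ℕ} {H : Vec n → ℝ≥0∞} (hH : Measurable H) :
    Measurable (rayInt n H) := by
  have : Measurable (fun q : Vec n × ℝ ↦ ENNReal.ofReal (q.2 ^ (n - 1)) * H (q.2 • q.1)) := by
    fun_prop
  exact this.lintegral_prod_right'

lemma lintegral_rayInt {n : ℕ} (hn : 1 ≤ n) {H : Vec n → ℝ≥0∞} (hH : Measurable H) :
    ∫⁻ ζ, rayInt n H ζ ∂(surf n) = ∫⁻ x, H x := (lintegral_polar hn hH).symm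

lemma lintegral_Icc_le_rayInt {n : ℕ} {H : Vec n → ℝ≥0∞} {ζ : Vec n} {s R : ℝ} (hs : 1 / 2 ≤ s) :
    ∫⁻ u in Icc s R, H (u • ζ) ≤ ENNReal.ofReal (2 ^ (n - 1)) * rayInt n H ζ := by
  rw [rayInt, ← lintegral_const_mul' _ _ ENNReal.ofReal_ne_top]
  have hsub : Icc s R ⊆ Ioi (0 : ℝ) := fun u hu ↦ by
    have := hu.1
    simp only [mem_Ioi]; linarith
  refine le_trans ?_ (lintegral_mono_set hsub)
  refine setLIntegral_mono' measurableSet_Icc fun u hu ↦ ?_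
  rw [← mul_assoc, ← ENNReal.ofReal_mul (by positivity), ← mul_pow]
  refine le_mul_of_one_le_left' ?_
  rw [ENNReal.one_le_ofReal]
  exact one_le_pow₀ (by linarith [hu.1])

lemma IsQR.measurable_indicator {n : ℕ} {K : ℝ} {f : Vec n → Vec n} (hf : IsQR n K f) :
    Measurable ((unitBall n).indicator f) := by
  rw [← Set.piecewise_eq_indicator]
  exact hf.1.measurable_piecewise continuousOn_const (measurableSet_unitBall n)

lemma IsQR.measurable_indicator_weight {n : ℕ} {K : ℝ} {f : Vec n → Vec n} (hf : IsQR n K f)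
    {W : ℝ → ℝ} (hW : Measurable W) {A : Set (Vec n)} (hA : MeasurableSet A)
    (hAB : A ⊆ unitBall n) :
    Measurable (A.indicator fun x ↦ ENNReal.ofReal (W ‖f x‖ * ‖fderiv ℝ f x‖)) := by
  have h1 : A.indicator (fun x ↦ ENNReal.ofReal (W ‖f x‖ * ‖fderiv ℝ f x‖)) =
      A.indicator fun x ↦ ENNReal.ofReal (W ‖(unitBall n).indicator f x‖ * ‖fderiv ℝ f x‖) := by
    refine Set.indicator_congr fun x hx ↦ ?_
    rw [Set.indicator_of_mem (hAB hx)]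
  rw [h1]
  have h2 := hf.measurable_indicator
  have h3 : Measurable fun x ↦ ‖fderiv ℝ f x‖ := (measurable_fderiv ℝ f).norm
  exact ((hW.comp h2.norm).mul h3).ennreal_ofReal.indicator hA

lemma IsQR.hasDerivAt_norm {n : ℕ} {K : ℝ} {f : Vec n → Vec n} (hf : IsQR n K f)
    (hf0 : ∀ x ∈ unitBall n, f x ≠ 0) {ζ : Vec n} (hζ : ‖ζ‖ = 1) {u : ℝ} (hu : u • ζ ∈ unitBall n) :
    ∃ d : ℝ, HasDerivAt (fun v : ℝ ↦ ‖f (v • ζ)‖) d u ∧ |d| ≤ ‖fderiv ℝ f (u • ζ)‖ := by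
  have h1 : HasDerivAt (fun v : ℝ ↦ f (v • ζ)) (fderiv ℝ f (u • ζ) ζ) u := by
    have e : HasDerivAt (fun v : ℝ ↦ v • ζ) ζ u := by
      simpa using (hasDerivAt_id u).smul_const ζ
    exact (hf.2.1 _ hu).hasFDerivAt.comp_hasDerivAt u e
  have hpos : 0 < ‖f (u • ζ)‖ := norm_pos_iff.2 (hf0 _ hu)
  have h2 := h1.norm_sq.sqrt (by positivity)
  simp only [Real.sqrt_sq (norm_nonneg _)] at h2
  refine ⟨_, h2, ?_⟩
  rw [abs_div, abs_of_pos (by positivity : 0 < 2 * ‖f (u • ζ)‖), div_le_iff₀ (by positivity),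
    abs_mul, abs_two]
  have h3 : ‖fderiv ℝ f (u • ζ) ζ‖ ≤ ‖fderiv ℝ f (u • ζ)‖ := by
    simpa [hζ] using (fderiv ℝ f (u • ζ)).le_opNorm ζ
  have h4 := abs_real_inner_le_norm (f (u • ζ)) (fderiv ℝ f (u • ζ) ζ)
  nlinarith [mul_le_mul_of_nonneg_left h3 hpos.le]

/-- The growth of a function of `‖f‖` along a ray. -/
lemma IsQR.ofReal_sub_le_rayInt {n : ℕ} {K : ℝ} {f : Vec n → Vec n} (hf : IsQR n K f)
    (hf0 : ∀ x ∈ unitBall n, f x ≠ 0) {Φ Φ' W : ℝ → ℝ} (hW : Measurable W)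
    (hΦ : ∀ v, 0 < v → HasDerivAt Φ (Φ' v) v) (hΦW : ∀ v, 0 < v → |Φ' v| ≤ W v)
    {A : Set (Vec n)} (hA : MeasurableSet A) (hAB : A ⊆ unitBall n) {ζ : Vec n} (hζ : ‖ζ‖ = 1)
    {s R : ℝ} (hs : 1 / 2 ≤ s) (hsR : s ≤ R) (hray : ∀ u ∈ Icc s R, u • ζ ∈ A) :
    ENNReal.ofReal (Φ ‖f (R • ζ)‖ - Φ ‖f (s • ζ)‖) ≤ ENNReal.ofReal (2 ^ (n - 1)) *
      rayInt n (A.indicator fun x ↦ ENNReal.ofReal (W ‖f x‖ * ‖fderiv ℝ f x‖)) ζ := by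
  set H := A.indicator fun x ↦ ENNReal.ofReal (W ‖f x‖ * ‖fderiv ℝ f x‖) with hHdef
  have hH : Measurable H := hf.measurable_indicator_weight hW hA hAB
  refine le_trans ?_ (lintegral_Icc_le_rayInt hs (R := R))
  by_cases hfin : ∫⁻ u in Icc s R, H (u • ζ) = ⊤
  · rw [hfin]; exact le_top
  set φ : ℝ → ℝ := fun u ↦ (H (u • ζ)).toReal with hφ
  have hHm : Measurable fun u : ℝ ↦ H (u • ζ) := by fun_prop
  have hφint : IntegrableOn φ (Icc s R) :=
    integrable_toReal_of_lintegral_ne_top hHm.aemeasurable hfin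
  have hval : ∀ u ∈ Icc s R, φ u = W ‖f (u • ζ)‖ * ‖fderiv ℝ f (u • ζ)‖ := by
    intro u hu
    have hpos : 0 < ‖f (u • ζ)‖ := norm_pos_iff.2 (hf0 _ (hAB (hray u hu)))
    have : 0 ≤ W ‖f (u • ζ)‖ := (abs_nonneg _).trans (hΦW _ hpos)
    rw [hφ, hHdef]
    simp only [Set.indicator_of_mem (hray u hu)]
    rw [ENNReal.toReal_ofReal (by positivity)]
  have hex : ∀ u ∈ Icc s R, ∃ d, HasDerivAt (fun v ↦ Φ ‖f (v • ζ)‖) d u ∧ d ≤ φ u := by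
    intro u hu
    have hpos : 0 < ‖f (u • ζ)‖ := norm_pos_iff.2 (hf0 _ (hAB (hray u hu)))
    obtain ⟨d, hd, hdle⟩ := hf.hasDerivAt_norm hf0 hζ (hAB (hray u hu))
    refine ⟨Φ' ‖f (u • ζ)‖ * d, (hΦ _ hpos).comp u hd, ?_⟩
    rw [hval u hu]
    calc _ ≤ |Φ' ‖f (u • ζ)‖ * d| := le_abs_self _
      _ = |Φ' ‖f (u • ζ)‖| * |d| := abs_mul _ _
      _ ≤ _ := mul_le_mul (hΦW _ hpos) hdle (abs_nonneg _) ((abs_nonneg _).trans (hΦW _ hpos))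
  choose! D hD hDle using hex
  have key := intervalIntegral.sub_le_integral_of_hasDeriv_right_of_le hsR
    (fun u hu ↦ (hD u hu).continuousAt.continuousWithinAt)
    (fun u hu ↦ (hD u (Ioo_subset_Icc_self hu)).hasDerivWithinAt) hφint
    (fun u hu ↦ hDle u (Ioo_subset_Icc_self hu))
  rw [intervalIntegral.integral_of_le hsR, ← integral_Icc_eq_integral_Ioc] at key
  refine (ENNReal.ofReal_le_ofReal key).trans ?_
  rw [ofReal_integral_eq_lintegral_ofReal hφint
    (Eventually.of_forall fun u ↦ ENNReal.toReal_nonneg)]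
  exact lintegral_mono fun u ↦ ENNReal.ofReal_toReal_le

/-- On a large part of each cap, `‖f‖` near the boundary is bounded below by its value at the point
above the cap. -/
lemma exists_good_set {n : ℕ} (hn : 2 ≤ n) {K C₀ α a C₁ : ℝ} (hK : 1 ≤ K)
    (hC₀ : 1 ≤ C₀) (hα : 0 < α) (ha0 : 0 ≤ a) (ha : a < (n : ℝ) - 1) (hC₁ : 0 < C₁)
    {f : Vec n → Vec n} (hf : IsQR n K f) (hf0 : ∀ x ∈ unitBall n, f x ≠ 0)
    (hMin : InMiniowitz n C₀ α f) (hM : MultCond n a C₁ f) :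
    ∃ c : ℝ, 0 < c ∧ ∃ c' : ℝ, 0 < c' ∧ ∀ ω : Vec n, ‖ω‖ = 1 → ∀ r : ℝ, 0 < r → r ≤ 1 →
      ∀ R : ℝ, 1 - r / 2 ≤ R → R < 1 → ENNReal.ofReal (c' * r ^ (n - 1)) ≤
        surf n {ζ ∈ closedBall ω r | ‖ζ‖ = 1 ∧ c * ‖f ((1 - r) • ω)‖ ≤ ‖f (R • ζ)‖} := by
  obtain ⟨C, hC, hCle⟩ := exists_carleson_le hn hK hC₀ hα ha0 ha hC₁ hf hf0 hMin hM
  obtain ⟨k, hk, hkle⟩ := exists_le_surf_closedBall (by omega : 1 ≤ n)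
  set M : ℝ := 2 * C / k with hMdef
  have hM0 : 0 < M := by positivity
  set L : ℝ := C₀ * (224 / (1 / 2)) ^ α with hL
  have hL0 : 0 < L := by positivity
  refine ⟨(Real.exp (2 ^ (n - 1) * M) * L)⁻¹, by positivity, k / 2, by positivity, ?_⟩
  intro ω hω r hr hr1 R hR hR1
  set A : Set (Vec n) := {z ∈ unitBall n | ‖z - ω‖ ≤ 5 * r} with hAdef
  have hA : MeasurableSet A := by
    have h1 : MeasurableSet {z : Vec n | ‖z - ω‖ ≤ 5 * r} :=
      measurableSet_le (by fun_prop) (by fun_prop)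
    exact (measurableSet_unitBall n).inter h1
  set H := A.indicator fun x ↦ ENNReal.ofReal (‖f x‖⁻¹ * ‖fderiv ℝ f x‖) with hHdef
  have hH : Measurable H :=
    hf.measurable_indicator_weight (W := fun v ↦ v⁻¹) measurable_inv hA (fun x hx ↦ hx.1)
  have hHint : ∫⁻ x, H x ≤ ENNReal.ofReal (C * r ^ (n - 1)) := by
    rw [hHdef, lintegral_indicator hA]
    simp only [← div_eq_inv_mul]
    exact hCle ω hω r hr hr1
  have hbad : surf n {ζ | ENNReal.ofReal M ≤ rayInt n H ζ} ≤
      ENNReal.ofReal (k / 2 * r ^ (n - 1)) := by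
    refine (meas_ge_le_lintegral_div (measurable_rayInt hH).aemeasurable
      (ENNReal.ofReal_pos.2 hM0).ne' ENNReal.ofReal_ne_top).trans ?_
    rw [lintegral_rayInt (by omega) hH]
    refine (ENNReal.div_le_div_right hHint _).trans ?_
    rw [← ENNReal.ofReal_div_of_pos hM0]
    refine le_of_eq ?_
    congr 1
    rw [hMdef]; field_simp
  have hgood : (closedBall ω r \ {ζ | ENNReal.ofReal M ≤ rayInt n H ζ}) ∩ {ζ | ‖ζ‖ = 1} ⊆
      {ζ ∈ closedBall ω r | ‖ζ‖ = 1 ∧ (Real.exp (2 ^ (n - 1) * M) * L)⁻¹ * ‖f ((1 - r) • ω)‖ ≤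
        ‖f (R • ζ)‖} := by
    rintro ζ ⟨⟨hζω, hζM⟩, hζ⟩
    refine ⟨hζω, hζ, ?_⟩
    replace hζ : ‖ζ‖ = 1 := hζ
    replace hζM : rayInt n H ζ < ENNReal.ofReal M := not_le.1 hζM
    rw [mem_closedBall, dist_eq_norm] at hζω
    have hdist : ∀ u, 1 - r / 2 ≤ u → u < 1 → u • ζ ∈ unitBall n ∧ ‖u • ζ - ω‖ ≤ 5 * r ∧
        ‖u • ζ‖ = u := by
      intro u hu hu1
      have h0 : ‖u • ζ‖ = u := by
        rw [norm_smul, hζ, mul_one, Real.norm_of_nonneg (by linarith)]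
      refine ⟨by rw [mem_unitBall, h0]; exact hu1, ?_, h0⟩
      calc ‖u • ζ - ω‖ = ‖(ζ - ω) - (1 - u) • ζ‖ := by congr 1; module
        _ ≤ ‖ζ - ω‖ + ‖(1 - u) • ζ‖ := norm_sub_le _ _
        _ ≤ r + r / 2 := by
          rw [norm_smul, hζ, mul_one, Real.norm_of_nonneg (by linarith)]
          linarith
        _ ≤ 5 * r := by linarith
    have hgrow := hf.ofReal_sub_le_rayInt hf0 (Φ := fun v ↦ -Real.log v) (Φ' := fun v ↦ -v⁻¹)
      (W := fun v ↦ v⁻¹) measurable_inv (fun v hv ↦ (Real.hasDerivAt_log hv.ne').neg)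
      (fun v hv ↦ by rw [abs_neg, abs_of_pos (inv_pos.2 hv)]) hA (fun x hx ↦ hx.1) hζ
      (by linarith : 1 / 2 ≤ 1 - r / 2) hR
      (fun u hu ↦ ⟨(hdist u hu.1 (hu.2.trans_lt hR1)).1, (hdist u hu.1 (hu.2.trans_lt hR1)).2.1⟩)
    have hgrow' : ENNReal.ofReal (-Real.log ‖f (R • ζ)‖ - -Real.log ‖f ((1 - r / 2) • ζ)‖) ≤
        ENNReal.ofReal (2 ^ (n - 1) * M) := by
      refine hgrow.trans ?_
      rw [ENNReal.ofReal_mul (by positivity)]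
      gcongr
    rw [ENNReal.ofReal_le_ofReal_iff (by positivity)] at hgrow'
    obtain ⟨hsB, hsω, hsn⟩ := hdist (1 - r / 2) le_rfl (by linarith)
    obtain ⟨hRB, -, -⟩ := hdist R hR hR1
    have hs0 : 0 < ‖f ((1 - r / 2) • ζ)‖ := norm_pos_iff.2 (hf0 _ hsB)
    have hR0 : 0 < ‖f (R • ζ)‖ := norm_pos_iff.2 (hf0 _ hRB)
    have hexp : ‖f ((1 - r / 2) • ζ)‖ ≤ Real.exp (2 ^ (n - 1) * M) * ‖f (R • ζ)‖ := by
      rw [← Real.log_le_log_iff hs0 (by positivity), Real.log_mul (by positivity) hR0.ne',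
        Real.log_exp]
      linarith
    have hhar := (hMin.harnack hC₀ hα hf0 hω hr hr1 (by norm_num : (0 : ℝ) < 1 / 2)
      (z := (1 - r / 2) • ζ) ⟨hsB, hsω, by rw [hsn]; linarith⟩).2
    rw [inv_mul_le_iff₀ (by positivity)]
    calc _ ≤ L * ‖f ((1 - r / 2) • ζ)‖ := hhar
      _ ≤ L * (Real.exp (2 ^ (n - 1) * M) * ‖f (R • ζ)‖) := by gcongr
      _ = _ := by ring
  refine le_trans ?_ (measure_mono hgood)
  have hsph : surf n ((closedBall ω r \ {ζ | ENNReal.ofReal M ≤ rayInt n H ζ}) ∩ {ζ | ‖ζ‖ = 1}) =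
      surf n (closedBall ω r \ {ζ | ENNReal.ofReal M ≤ rayInt n H ζ}) :=
    measure_inter_conull (by exact surf_ae_norm n)
  rw [hsph]
  refine le_trans ?_ le_measure_sdiff
  refine le_trans ?_ (tsub_le_tsub (hkle ω hω r hr hr1) hbad)
  rw [← ENNReal.ofReal_sub _ (by positivity)]
  refine le_of_eq ?_
  congr 1
  ring

lemma exists_norm_eq_one_smul {n : ℕ} (hn : 1 ≤ n) (x : Vec n) :
    ∃ ω : Vec n, ‖ω‖ = 1 ∧ ‖x‖ • ω = x := by
  have : NeZero n := ⟨by omega⟩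
  by_cases hx : x = 0
  · obtain ⟨e, he⟩ := exists_norm_eq (Vec n) (zero_le_one (α := ℝ))
    exact ⟨e, he, by simp [hx]⟩
  · have h : ‖x‖ ≠ 0 := norm_ne_zero_iff.2 hx
    refine ⟨‖x‖⁻¹ • x, ?_, ?_⟩
    · rw [norm_smul, norm_inv, norm_norm, inv_mul_cancel₀ h]
    · rw [smul_smul, mul_inv_cancel₀ h, one_smul]

/-- The distributional inequality between `‖f‖` in the ball and `‖f‖` on a sphere. -/
lemma exists_distribution_le {n : ℕ} (hn : 2 ≤ n) {K C₀ α a C₁ : ℝ} (hK : 1 ≤ K)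
    (hC₀ : 1 ≤ C₀) (hα : 0 < α) (ha0 : 0 ≤ a) (ha : a < (n : ℝ) - 1) (hC₁ : 0 < C₁)
    {f : Vec n → Vec n} (hf : IsQR n K f) (hf0 : ∀ x ∈ unitBall n, f x ≠ 0)
    (hMin : InMiniowitz n C₀ α f) (hM : MultCond n a C₁ f) :
    ∃ c : ℝ, 0 < c ∧ ∃ D : ℝ, 0 < D ∧ ∀ R : ℝ, R < 1 → ∀ t : ℝ,
      ∫⁻ x in {x | ‖x‖ ≤ 2 * R - 1 ∧ t ≤ ‖f x‖}, ENNReal.ofReal (‖fderiv ℝ f x‖ / ‖f x‖) ≤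
        ENNReal.ofReal D *
          surf n {ζ | ‖ζ‖ = 1 ∧ c * t ≤ ‖(unitBall n).indicator f (R • ζ)‖} := by
  obtain ⟨C, hC, hCle⟩ := exists_carleson_le hn hK hC₀ hα ha0 ha hC₁ hf hf0 hMin hM
  obtain ⟨c, hc, c', hc', hgood⟩ := exists_good_set hn hK hC₀ hα ha0 ha hC₁ hf hf0 hMin hM
  refine ⟨c, hc, C / c', by positivity, fun R hR t ↦ ?_⟩
  rcases lt_or_ge (2 * R - 1) 0 with hR0 | hR0
  · have : {x : Vec n | ‖x‖ ≤ 2 * R - 1 ∧ t ≤ ‖f x‖} = ∅ :=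
      Set.eq_empty_of_forall_notMem fun x hx ↦ by linarith [norm_nonneg x, hx.1]
    rw [this]; simp
  choose e he hex using exists_norm_eq_one_smul (by omega : 1 ≤ n)
  set S : Set (Vec n) := {x | ‖x‖ ≤ 2 * R - 1 ∧ t ≤ ‖f x‖} with hS
  set T : Set (Vec n) := {ζ | ‖ζ‖ = 1 ∧ c * t ≤ ‖(unitBall n).indicator f (R • ζ)‖} with hT
  have hTm : MeasurableSet T := by
    have h0 := hf.measurable_indicator
    have h1 : MeasurableSet {ζ : Vec n | ‖ζ‖ = 1} :=
      measurableSet_eq_fun (by fun_prop) (by fun_prop)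
    have h2 : MeasurableSet {ζ : Vec n | c * t ≤ ‖(unitBall n).indicator f (R • ζ)‖} :=
      measurableSet_le (by fun_prop) ((h0.comp (measurable_const_smul R)).norm)
    exact h1.inter h2
  obtain ⟨u, huS, hdisj, hcov⟩ := Vitali.exists_disjoint_subfamily_covering_enlargement_closedBall
    S e (fun x ↦ 1 - ‖x‖) 1 (fun x _ ↦ by linarith [norm_nonneg x]) 5 (by norm_num)
  have hrpos : ∀ x ∈ S, 0 < 1 - ‖x‖ := fun x hx ↦ by linarith [hx.1]
  have hu : u.Countable := hdisj.countable_of_nonempty_interior fun x hx ↦ by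
    refine ⟨e x, ball_subset_interior_closedBall (mem_ball_self (hrpos x (huS hx)))⟩
  have : Countable u := hu.to_subtype
  have hSsub : S ⊆ ⋃ b : u, {z ∈ unitBall n | ‖z - e b‖ ≤ 5 * (1 - ‖(b : Vec n)‖)} := by
    intro x hx
    obtain ⟨b, hb, hsub⟩ := hcov x hx
    refine mem_iUnion.2 ⟨⟨b, hb⟩, mem_unitBall.2 (by linarith [hrpos x hx]), ?_⟩
    have hmem : x ∈ closedBall (e x) (1 - ‖x‖) := by
      have : x - e x = -((1 - ‖x‖) • e x) := by
        nth_rewrite 1 [← hex x]; module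
      rw [mem_closedBall, dist_eq_norm, this, norm_neg, norm_smul, he, mul_one,
        Real.norm_of_nonneg (hrpos x hx).le]
    have := hsub hmem
    rwa [mem_closedBall, dist_eq_norm] at this
  have hcap : ∀ b : u, ENNReal.ofReal (c' * (1 - ‖(b : Vec n)‖) ^ (n - 1)) ≤
      surf n (T ∩ closedBall (e b) (1 - ‖(b : Vec n)‖)) := by
    intro b
    have hbS := huS b.2
    refine (hgood (e b) (he b) _ (hrpos b hbS) (by linarith [norm_nonneg (b : Vec n)]) R
      (by linarith [hbS.1]) hR).trans (measure_mono ?_)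
    rintro ζ ⟨hζ, hζ1, hζf⟩
    refine ⟨⟨hζ1, ?_⟩, hζ⟩
    rw [sub_sub_cancel, hex] at hζf
    have hRζ : R • ζ ∈ unitBall n := by
      rw [mem_unitBall, norm_smul, hζ1, mul_one, Real.norm_of_nonneg (by linarith)]; exact hR
    rw [Set.indicator_of_mem hRζ]
    exact le_trans (mul_le_mul_of_nonneg_left hbS.2 hc.le) hζf
  calc ∫⁻ x in S, ENNReal.ofReal (‖fderiv ℝ f x‖ / ‖f x‖)
      ≤ ∫⁻ x in ⋃ b : u, {z ∈ unitBall n | ‖z - e b‖ ≤ 5 * (1 - ‖(b : Vec n)‖)},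
          ENNReal.ofReal (‖fderiv ℝ f x‖ / ‖f x‖) := lintegral_mono_set hSsub
    _ ≤ ∑' b : u, ∫⁻ x in {z ∈ unitBall n | ‖z - e b‖ ≤ 5 * (1 - ‖(b : Vec n)‖)},
          ENNReal.ofReal (‖fderiv ℝ f x‖ / ‖f x‖) := lintegral_iUnion_le _ _
    _ ≤ ∑' b : u, ENNReal.ofReal (C / c') *
          surf n (T ∩ closedBall (e b) (1 - ‖(b : Vec n)‖)) := by
        refine ENNReal.tsum_le_tsum fun b ↦ ?_
        refine (hCle (e b) (he b) _ (hrpos b (huS b.2))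
          (by linarith [norm_nonneg (b : Vec n)])).trans ?_
        refine le_trans (le_of_eq ?_) (mul_le_mul_right (hcap b) _)
        rw [← ENNReal.ofReal_mul (by positivity)]
        congr 1
        field_simp
    _ = ENNReal.ofReal (C / c') * ∑' b : u, surf n (T ∩ closedBall (e b) (1 - ‖(b : Vec n)‖)) :=
        ENNReal.tsum_mul_left
    _ ≤ ENNReal.ofReal (C / c') * surf n T := by
        gcongr
        refine (tsum_meas_le_meas_iUnion_of_disjoint _
          (fun b ↦ hTm.inter isClosed_closedBall.measurableSet) ?_).trans
          (measure_mono (iUnion_subset fun b ↦ inter_subset_left))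
        intro b b' hbb'
        exact (hdisj b.2 b'.2 (fun h ↦ hbb' (Subtype.ext h))).mono inter_subset_right
          inter_subset_right

/-- The weighted area integral over a smaller ball is controlled by the mean over a sphere. -/
lemma exists_lintegral_ball_le {n : ℕ} (hn : 2 ≤ n) {K C₀ α a C₁ p : ℝ} (hK : 1 ≤ K)
    (hC₀ : 1 ≤ C₀) (hα : 0 < α) (ha0 : 0 ≤ a) (ha : a < (n : ℝ) - 1) (hC₁ : 0 < C₁) (hp : 0 < p)
    {f : Vec n → Vec n} (hf : IsQR n K f) (hf0 : ∀ x ∈ unitBall n, f x ≠ 0)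
    (hMin : InMiniowitz n C₀ α f) (hM : MultCond n a C₁ f) :
    ∃ D : ℝ, 0 < D ∧ ∀ R ∈ Ioo (0 : ℝ) 1,
      ∫⁻ x in closedBall (0 : Vec n) (2 * R - 1),
        ENNReal.ofReal (‖f x‖ ^ (p - 1) * ‖fderiv ℝ f x‖) ≤
          ENNReal.ofReal D * ∫⁻ ζ, ENNReal.ofReal (‖f (R • ζ)‖ ^ p) ∂(surf n) := by
  obtain ⟨c, hc, D, hD, hle⟩ := exists_distribution_le hn hK hC₀ hα ha0 ha hC₁ hf hf0 hMin hM
  refine ⟨D * (c⁻¹) ^ p, by positivity, ?_⟩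
  rintro R ⟨hR0, hR⟩
  set φ := (unitBall n).indicator f with hφ
  have hφm : Measurable φ := hf.measurable_indicator
  have hφf : ∀ x ∈ unitBall n, φ x = f x := fun x hx ↦ Set.indicator_of_mem hx f
  set G : Vec n → ℝ≥0∞ :=
    (unitBall n).indicator fun x ↦ ENNReal.ofReal (‖f x‖⁻¹ * ‖fderiv ℝ f x‖) with hG
  have hGm : Measurable G := hf.measurable_indicator_weight (W := fun v ↦ v⁻¹) measurable_inv
    (measurableSet_unitBall n) subset_rfl
  have hballsub : closedBall (0 : Vec n) (2 * R - 1) ⊆ unitBall n := fun x hx ↦ by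
    rw [mem_closedBall_zero_iff] at hx
    rw [mem_unitBall]; linarith
  have hballm : MeasurableSet (closedBall (0 : Vec n) (2 * R - 1)) :=
    isClosed_closedBall.measurableSet
  set ν : Measure (Vec n) :=
    (volume.restrict (closedBall (0 : Vec n) (2 * R - 1))).withDensity G with hν
  have hdist : ∀ t, ν {x | t ≤ ‖φ x‖} ≤
      ENNReal.ofReal D * surf n {ζ | t ≤ c⁻¹ * ‖φ (R • ζ)‖} := by
    intro t
    have hm : MeasurableSet {x | t ≤ ‖φ x‖} := measurableSet_le measurable_const hφm.norm
    rw [hν, withDensity_apply _ hm, Measure.restrict_restrict hm]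
    have e : {x | t ≤ ‖φ x‖} ∩ closedBall (0 : Vec n) (2 * R - 1) =
        {x | ‖x‖ ≤ 2 * R - 1 ∧ t ≤ ‖f x‖} := by
      ext x
      constructor
      · rintro ⟨h1, h2⟩
        refine ⟨mem_closedBall_zero_iff.1 h2, ?_⟩
        rw [← hφf x (hballsub h2)]; exact h1
      · rintro ⟨h1, h2⟩
        have h3 := mem_closedBall_zero_iff.2 h1
        refine ⟨?_, h3⟩
        rw [← hφf x (hballsub h3)] at h2; exact h2
    have e2 : ∫⁻ x in {x | t ≤ ‖φ x‖} ∩ closedBall (0 : Vec n) (2 * R - 1), G x =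
        ∫⁻ x in {x | ‖x‖ ≤ 2 * R - 1 ∧ t ≤ ‖f x‖},
          ENNReal.ofReal (‖fderiv ℝ f x‖ / ‖f x‖) := by
      rw [← e]
      refine setLIntegral_congr_fun (hm.inter hballm) fun x hx ↦ ?_
      simp only [hG, Set.indicator_of_mem (hballsub hx.2), div_eq_inv_mul]
    rw [e2]
    refine (hle R hR t).trans ?_
    refine mul_le_mul_right (measure_mono ?_) _
    rintro ζ ⟨-, hζ⟩
    change t ≤ c⁻¹ * ‖φ (R • ζ)‖
    rw [le_inv_mul_iff₀ hc]
    exact hζ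
  have hleft : ∫⁻ x in closedBall (0 : Vec n) (2 * R - 1),
      ENNReal.ofReal (‖f x‖ ^ (p - 1) * ‖fderiv ℝ f x‖) = ∫⁻ x, ENNReal.ofReal (‖φ x‖ ^ p) ∂ν := by
    rw [hν, lintegral_withDensity_eq_lintegral_mul _ hGm (by fun_prop)]
    refine setLIntegral_congr_fun hballm fun x hx ↦ ?_
    have hxB := hballsub hx
    have hpos : 0 < ‖f x‖ := norm_pos_iff.2 (hf0 x hxB)
    simp only [Pi.mul_apply, hG, Set.indicator_of_mem hxB, hφf x hxB]
    rw [← ENNReal.ofReal_mul (by positivity), Real.rpow_sub_one hpos.ne']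
    congr 1
    field_simp
  have hmeas : Measurable fun ζ ↦ c⁻¹ * ‖φ (R • ζ)‖ :=
    ((hφm.comp (measurable_const_smul R)).norm).const_mul _
  rw [hleft, lintegral_rpow_eq_lintegral_meas_le_mul ν
    (Eventually.of_forall fun x ↦ norm_nonneg _) hφm.norm.aemeasurable hp]
  calc _ ≤ ENNReal.ofReal p * ∫⁻ t in Ioi (0 : ℝ), ENNReal.ofReal D *
        (surf n {ζ | t ≤ c⁻¹ * ‖φ (R • ζ)‖} * ENNReal.ofReal (t ^ (p - 1))) := by
        refine mul_le_mul_right (lintegral_mono fun t ↦ ?_) _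
        rw [← mul_assoc]
        exact mul_le_mul_left (hdist t) _
    _ = ENNReal.ofReal D * ∫⁻ ζ, ENNReal.ofReal ((c⁻¹ * ‖φ (R • ζ)‖) ^ p) ∂(surf n) := by
        rw [lintegral_const_mul' _ _ ENNReal.ofReal_ne_top,
          lintegral_rpow_eq_lintegral_meas_le_mul (surf n)
          (Eventually.of_forall fun ζ ↦ by positivity) hmeas.aemeasurable hp]
        ring
    _ = ENNReal.ofReal D * ∫⁻ ζ, ENNReal.ofReal (c⁻¹ ^ p) *
          ENNReal.ofReal (‖f (R • ζ)‖ ^ p) ∂(surf n) := by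
        congr 1
        refine lintegral_congr_ae ?_
        filter_upwards [surf_ae_norm n] with ζ hζ
        have hRζ : R • ζ ∈ unitBall n := by
          rw [mem_unitBall, norm_smul, hζ, mul_one, Real.norm_of_nonneg hR0.le]; exact hR
        rw [hφf _ hRζ, Real.mul_rpow (by positivity) (norm_nonneg _),
          ENNReal.ofReal_mul (by positivity)]
    _ = _ := by
        rw [lintegral_const_mul' _ _ ENNReal.ofReal_ne_top, ← mul_assoc,
          ← ENNReal.ofReal_mul hD.le]

lemma unitBall_eq_iUnion_closedBall (n : ℕ) :
    unitBall n = ⋃ k : ℕ, closedBall (0 : Vec n) (2 * (1 - 1 / ((k : ℝ) + 2)) - 1) := by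
  ext x
  rw [mem_unitBall, mem_iUnion]
  simp only [mem_closedBall_zero_iff]
  constructor
  · intro hx
    obtain ⟨k, hk⟩ := exists_nat_gt (2 / (1 - ‖x‖))
    refine ⟨k, ?_⟩
    have h1 : 0 < 1 - ‖x‖ := by linarith
    rw [div_lt_iff₀ h1] at hk
    have h2 : 1 / ((k : ℝ) + 2) ≤ (1 - ‖x‖) / 2 := by
      rw [div_le_div_iff₀ (by positivity) (by norm_num)]
      nlinarith
    linarith
  · rintro ⟨k, hk⟩
    have : 0 < 1 / ((k : ℝ) + 2) := by positivity
    linarith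

lemma sphMeasure_unitSphere (n : ℕ) : sphMeasure n (unitSphere n) = sphMeasure n univ := by
  rw [sphMeasure, Measure.restrict_apply_self, Measure.restrict_apply_univ]

lemma sphMeasure_univ_lt_top {n : ℕ} (hn : 2 ≤ n) : sphMeasure n univ < ⊤ := by
  obtain ⟨C, -, hC⟩ := exists_sphMeasure_le_surf hn
  refine (hC univ).trans_lt ?_
  rw [Measure.smul_apply, smul_eq_mul]
  exact ENNReal.mul_lt_top ENNReal.ofReal_lt_top (measure_lt_top _ _)

lemma sphMeasure_univ_ne_zero {n : ℕ} (hn : 2 ≤ n) : sphMeasure n univ ≠ 0 := by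
  obtain ⟨C, hC0, hC⟩ := exists_surf_le_sphMeasure hn
  obtain ⟨c, hc, hcle⟩ := exists_le_surf_closedBall (by omega : 1 ≤ n)
  intro h
  obtain ⟨ω, hω, -⟩ := exists_norm_eq_one_smul (by omega : 1 ≤ n) (0 : Vec n)
  have h1 := hcle ω hω 1 one_pos le_rfl
  have h2 : surf n univ ≤ 0 := by
    refine (hC univ).trans ?_
    rw [Measure.smul_apply, smul_eq_mul, h, mul_zero]
  have h3 := h1.trans ((measure_mono (subset_univ _)).trans h2)
  rw [one_pow, mul_one, nonpos_iff_eq_zero, ENNReal.ofReal_eq_zero] at h3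
  linarith

lemma memHp_iff {n : ℕ} {p : ℝ} (hp : 0 < p) {f : Vec n → Vec n} :
    MemHp n p f ↔ ⨆ r ∈ Ioo (0 : ℝ) 1, hardyMean n p f r < ⊤ := by
  rw [MemHp, hardyNorm, ENNReal.rpow_lt_top_iff_of_pos (by positivity)]

lemma lintegral_lt_top_of_memHp {n : ℕ} (hn : 2 ≤ n) {K C₀ α a C₁ p : ℝ} (hK : 1 ≤ K)
    (hC₀ : 1 ≤ C₀) (hα : 0 < α) (ha0 : 0 ≤ a) (ha : a < (n : ℝ) - 1) (hC₁ : 0 < C₁) (hp : 0 < p)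
    {f : Vec n → Vec n} (hf : IsQR n K f) (hf0 : ∀ x ∈ unitBall n, f x ≠ 0)
    (hMin : InMiniowitz n C₀ α f) (hM : MultCond n a C₁ f) (h : MemHp n p f) :
    ∫⁻ x in unitBall n, ENNReal.ofReal (‖f x‖ ^ (p - 1) * ‖fderiv ℝ f x‖) < ⊤ := by
  obtain ⟨D, -, hD⟩ := exists_lintegral_ball_le hn hK hC₀ hα ha0 ha hC₁ hp hf hf0 hMin hM
  obtain ⟨C, -, hC⟩ := exists_surf_le_sphMeasure hn
  rw [memHp_iff hp] at h
  set M := ⨆ r ∈ Ioo (0 : ℝ) 1, hardyMean n p f r with hMdef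
  have hbound : ∀ R ∈ Ioo (0 : ℝ) 1, ∫⁻ x in closedBall (0 : Vec n) (2 * R - 1),
      ENNReal.ofReal (‖f x‖ ^ (p - 1) * ‖fderiv ℝ f x‖) ≤
        ENNReal.ofReal D * (ENNReal.ofReal C * (sphMeasure n univ * M)) := by
    intro R hR
    refine (hD R hR).trans ?_
    gcongr
    calc _ ≤ ∫⁻ ζ, ENNReal.ofReal (‖f (R • ζ)‖ ^ p) ∂(ENNReal.ofReal C • sphMeasure n) :=
          lintegral_mono' hC le_rfl
      _ = ENNReal.ofReal C * ∫⁻ ζ, ENNReal.ofReal (‖f (R • ζ)‖ ^ p) ∂(sphMeasure n) := by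
          rw [lintegral_smul_measure, smul_eq_mul]
      _ = ENNReal.ofReal C * (sphMeasure n univ * hardyMean n p f R) := by
          rw [hardyMean, sphMeasure_unitSphere, ← mul_assoc (sphMeasure n univ),
            ENNReal.mul_inv_cancel (sphMeasure_univ_ne_zero hn) (sphMeasure_univ_lt_top hn).ne,
            one_mul]
      _ ≤ _ := by
          gcongr
          exact le_iSup₂ (f := fun r (_ : r ∈ Ioo (0 : ℝ) 1) ↦ hardyMean n p f r) R hR
  rw [unitBall_eq_iUnion_closedBall, setLIntegral_iUnion_of_directed]
  · refine (iSup_le fun k : ℕ ↦ hbound (1 - 1 / ((k : ℝ) + 2)) ⟨?_, ?_⟩).trans_lt ?_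
    · rw [sub_pos, div_lt_one (by positivity)]
      have : (0 : ℝ) ≤ k := Nat.cast_nonneg k
      linarith
    · have : 0 < 1 / ((k : ℝ) + 2) := by positivity
      linarith
    · exact ENNReal.mul_lt_top ENNReal.ofReal_lt_top (ENNReal.mul_lt_top ENNReal.ofReal_lt_top
        (ENNReal.mul_lt_top (sphMeasure_univ_lt_top hn) h))
  · refine Monotone.directed_le fun j k hjk ↦ closedBall_subset_closedBall ?_
    gcongr

lemma memHp_of_lintegral_lt_top {n : ℕ} (hn : 2 ≤ n) {K p : ℝ} (hp : 0 < p)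
    {f : Vec n → Vec n} (hf : IsQR n K f) (hf0 : ∀ x ∈ unitBall n, f x ≠ 0)
    (h : ∫⁻ x in unitBall n, ENNReal.ofReal (‖f x‖ ^ (p - 1) * ‖fderiv ℝ f x‖) < ⊤) :
    MemHp n p f := by
  rw [memHp_iff hp]
  obtain ⟨C, -, hC⟩ := exists_sphMeasure_le_surf hn
  obtain ⟨M, hMle⟩ : ∃ M, ∀ x ∈ closedBall (0 : Vec n) (1 / 2), ‖f x‖ ≤ M :=
    (isCompact_closedBall _ _).exists_bound_of_continuousOn (hf.1.mono fun x hx ↦ by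
      rw [mem_closedBall_zero_iff] at hx
      rw [mem_unitBall]; linarith)
  set W : ℝ → ℝ := fun v ↦ p * v ^ (p - 1) with hW
  have hWm : Measurable W := by fun_prop
  set H := (unitBall n).indicator fun x ↦ ENNReal.ofReal (W ‖f x‖ * ‖fderiv ℝ f x‖) with hHdef
  have hH : Measurable H :=
    hf.measurable_indicator_weight hWm (measurableSet_unitBall n) subset_rfl
  have hHint : ∫⁻ x, H x < ⊤ := by
    rw [hHdef, lintegral_indicator (measurableSet_unitBall n)]
    simp only [hW, mul_assoc, ENNReal.ofReal_mul hp.le]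
    rw [lintegral_const_mul' _ _ ENNReal.ofReal_ne_top]
    exact ENNReal.mul_lt_top ENNReal.ofReal_lt_top h
  have hpt : ∀ R ∈ Ioo (0 : ℝ) 1, ∀ ζ : Vec n, ‖ζ‖ = 1 → ENNReal.ofReal (‖f (R • ζ)‖ ^ p) ≤
      ENNReal.ofReal (M ^ p) + ENNReal.ofReal (2 ^ (n - 1)) * rayInt n H ζ := by
    rintro R ⟨hR0, hR1⟩ ζ hζ
    have hnorm : ∀ u : ℝ, 0 ≤ u → ‖u • ζ‖ = u := fun u hu ↦ by
      rw [norm_smul, hζ, mul_one, Real.norm_of_nonneg hu]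
    have hsmall : ∀ u : ℝ, 0 ≤ u → u ≤ 1 / 2 → ‖f (u • ζ)‖ ^ p ≤ M ^ p := fun u hu hu2 ↦
      Real.rpow_le_rpow (norm_nonneg _)
        (hMle _ (by rw [mem_closedBall_zero_iff, hnorm u hu]; exact hu2)) hp.le
    rcases le_total R (1 / 2) with hR | hR
    · exact le_add_right (ENNReal.ofReal_le_ofReal (hsmall R hR0.le hR))
    · have hgrow := hf.ofReal_sub_le_rayInt hf0 (Φ := fun v ↦ v ^ p) (Φ' := W) hWm
        (fun v hv ↦ Real.hasDerivAt_rpow_const (Or.inl hv.ne'))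
        (fun v hv ↦ by rw [abs_of_nonneg]; positivity)
        (measurableSet_unitBall n) subset_rfl hζ le_rfl hR
        (fun u hu ↦ by rw [mem_unitBall, hnorm u (by linarith [hu.1])]; linarith [hu.2])
      calc ENNReal.ofReal (‖f (R • ζ)‖ ^ p)
          = ENNReal.ofReal (‖f ((1 / 2 : ℝ) • ζ)‖ ^ p +
              (‖f (R • ζ)‖ ^ p - ‖f ((1 / 2 : ℝ) • ζ)‖ ^ p)) := by rw [add_sub_cancel]
        _ ≤ _ := ENNReal.ofReal_add_le
        _ ≤ _ := add_le_add (ENNReal.ofReal_le_ofReal (hsmall _ (by norm_num) le_rfl)) hgrow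
  have hsurf : ∀ R ∈ Ioo (0 : ℝ) 1, ∫⁻ ζ, ENNReal.ofReal (‖f (R • ζ)‖ ^ p) ∂(surf n) ≤
      ENNReal.ofReal (M ^ p) * surf n univ + ENNReal.ofReal (2 ^ (n - 1)) * ∫⁻ x, H x := by
    intro R hR
    calc _ ≤ ∫⁻ ζ, (ENNReal.ofReal (M ^ p) + ENNReal.ofReal (2 ^ (n - 1)) * rayInt n H ζ)
            ∂(surf n) := by
          refine lintegral_mono_ae ?_
          filter_upwards [surf_ae_norm n] with ζ hζ
          exact hpt R hR ζ hζ
      _ = _ := by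
          rw [lintegral_add_left measurable_const, lintegral_const,
            lintegral_const_mul' _ _ ENNReal.ofReal_ne_top, lintegral_rayInt (by omega) hH]
  refine (iSup₂_le fun R hR ↦ ?_ : _ ≤ (sphMeasure n univ)⁻¹ * (ENNReal.ofReal C *
    (ENNReal.ofReal (M ^ p) * surf n univ + ENNReal.ofReal (2 ^ (n - 1)) * ∫⁻ x, H x))).trans_lt ?_
  · rw [hardyMean, sphMeasure_unitSphere]
    gcongr
    calc _ ≤ ∫⁻ ζ, ENNReal.ofReal (‖f (R • ζ)‖ ^ p) ∂(ENNReal.ofReal C • surf n) :=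
          lintegral_mono' hC le_rfl
      _ = ENNReal.ofReal C * ∫⁻ ζ, ENNReal.ofReal (‖f (R • ζ)‖ ^ p) ∂(surf n) := by
          rw [lintegral_smul_measure, smul_eq_mul]
      _ ≤ _ := by
          gcongr
          exact hsurf R hR
  · refine ENNReal.mul_lt_top (ENNReal.inv_lt_top.2
      (pos_iff_ne_zero.2 (sphMeasure_univ_ne_zero hn))) (ENNReal.mul_lt_top ENNReal.ofReal_lt_top
      (ENNReal.add_lt_top.2 ⟨?_, ?_⟩))
    · exact ENNReal.mul_lt_top ENNReal.ofReal_lt_top (measure_lt_top _ _)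
    · exact ENNReal.mul_lt_top ENNReal.ofReal_lt_top hHint

theorem hp_iff_integral (n : ℕ) (hn : 2 ≤ n) (K C₀ α a C₁ p : ℝ)
    (hK : 1 ≤ K) (hC₀ : 1 ≤ C₀) (hα : 0 < α) (ha0 : 0 ≤ a) (ha : a < (n : ℝ) - 1)
    (hC₁ : 0 < C₁) (hp : 0 < p)
    (f : Vec n → Vec n) (hf : IsQR n K f) (hf0 : ∀ x ∈ unitBall n, f x ≠ 0)
    (hMin : InMiniowitz n C₀ α f) (hM : MultCond n a C₁ f) :
    MemHp n p f ↔
      ∫⁻ x in unitBall n,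
        ENNReal.ofReal (‖f x‖ ^ (p - 1) * ‖fderiv ℝ f x‖) < ⊤ := by
  exact ⟨lintegral_lt_top_of_memHp hn hK hC₀ hα ha0 ha hC₁ hp hf hf0 hMin hM,
    memHp_of_lintegral_lt_top hn hp hf hf0⟩

end
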